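/- arXiv:2009.06691 — 2 statements merged into one kernel-verified Lean document; each statement's English description precedes it below -/
import Mathlib

section
/- The number of subgroups of index n in π₁(𝒢₆) that are isomorphic to ℤ³ equals ω(n/4), where ω(m) = Σ_{abc=m} a²b and ω(n/4) = 0 if 4 ∤ n. -/
/-- The relations of the Hantzsche–Wendt group:
`x y² x⁻¹ y² = 1`, `y x² y⁻¹ x² = 1`, `x y z = 1`, with `x, y, z` the generators `0, 1, 2`. -/
def hwRels : Set (FreeGroup (Fin 3)) :=
  { FreeGroup.of 0 * FreeGroup.of 1 ^ 2 * (FreeGroup.of 0)⁻¹ * FreeGroup.of 1 ^ 2,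
    FreeGroup.of 1 * FreeGroup.of 0 ^ 2 * (FreeGroup.of 1)⁻¹ * FreeGroup.of 0 ^ 2,
    FreeGroup.of 0 * FreeGroup.of 1 * FreeGroup.of 2 }

/-- The fundamental group of the Hantzsche–Wendt manifold `𝒢₆`. -/
abbrev HW : Type := PresentedGroup hwRels

def hwx : HW := PresentedGroup.of 0
def hwy : HW := PresentedGroup.of 1
def hwz : HW := PresentedGroup.of 2

/-- `omegaFn n = ∑_{a*b*c = n} a² * b`, summing over ordered triples of positive integers. -/
def omegaFn (n : ℕ) : ℕ :=
  ∑ t ∈ (Finset.range (n+1) ×ˢ Finset.range (n+1) ×ˢ Finset.range (n+1)).filter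
      (fun t => 0 < t.1 ∧ 0 < t.2.1 ∧ 0 < t.2.2 ∧ t.1 * t.2.1 * t.2.2 = n),
    t.1 ^ 2 * t.2.1

namespace AddSubgroup

theorem index_eq_index_comap_inl_mul_index_map_snd {A B : Type*} [AddCommGroup A]
    [AddCommGroup B] (L : AddSubgroup (A × B)) :
    L.index = (L.comap (AddMonoidHom.inl A B)).index * (L.map (AddMonoidHom.snd A B)).index := by
  have hrange : (AddMonoidHom.inl A B).range = (AddMonoidHom.snd A B).ker := by
    ext ⟨a, b⟩
    exact ⟨fun ⟨_, h⟩ ↦ (congrArg Prod.snd h).symm, fun h ↦ ⟨a, Prod.ext rfl (Eq.symm h)⟩⟩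
  rw [index_comap, hrange, index_map,
    AddMonoidHom.range_eq_top_of_surjective _ fun b ↦ ⟨(0, b), rfl⟩, index_top, mul_one,
    ← relIndex_sup_left, relIndex_mul_index le_sup_left]

theorem eq_zmultiples_index (L : AddSubgroup ℤ) :
    L = AddSubgroup.zmultiples (L.index : ℤ) := by
  obtain ⟨a, rfl⟩ := Int.subgroup_cyclic L
  rw [← zmultiples_eq_closure, Int.index_zmultiples, Int.zmultiples_natAbs]

/-- The subgroup of `A × ℤ` that meets `A` in `L`, projects onto `cℤ`, and contains `(v, c)`
for the representatives `v` of `q`. -/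
def latticeExtension {A : Type*} [AddCommGroup A] (c : ℤ) (L : AddSubgroup A)
    (q : A ⧸ L) : AddSubgroup (A × ℤ) where
  carrier := {p | ∃ j : ℤ, p.2 = c * j ∧ (p.1 : A ⧸ L) = j • q}
  zero_mem' := ⟨0, by simp⟩
  add_mem' := by
    rintro p p' ⟨j, hj, hq⟩ ⟨j', hj', hq'⟩
    exact ⟨j + j', by simp [hj, hj', mul_add], by simp [hq, hq', add_smul]⟩
  neg_mem' := by
    rintro p ⟨j, hj, hq⟩
    exact ⟨-j, by simp [hj], by simp [hq]⟩

variable {A : Type*} [AddCommGroup A]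

theorem mem_latticeExtension {c : ℤ} {L : AddSubgroup A} {q : A ⧸ L} {p : A × ℤ} :
    p ∈ latticeExtension c L q ↔ ∃ j : ℤ, p.2 = c * j ∧ (p.1 : A ⧸ L) = j • q :=
  Iff.rfl

theorem comap_inl_latticeExtension {c : ℤ} (hc : c ≠ 0) (L : AddSubgroup A) (q : A ⧸ L) :
    (latticeExtension c L q).comap (AddMonoidHom.inl A ℤ) = L := by
  ext a
  simp [mem_latticeExtension, hc]

theorem map_snd_latticeExtension (c : ℤ) (L : AddSubgroup A) (q : A ⧸ L) :
    (latticeExtension c L q).map (AddMonoidHom.snd A ℤ) = zmultiples c := by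
  ext k
  obtain ⟨v, rfl⟩ := QuotientAddGroup.mk_surjective q
  simp only [mem_map, mem_latticeExtension, mem_zmultiples_iff, smul_eq_mul]
  constructor
  · rintro ⟨p, ⟨j, hj, -⟩, rfl⟩
    exact ⟨j, by simp [hj, mul_comm]⟩
  · rintro ⟨j, rfl⟩
    exact ⟨(j • v, c * j), ⟨j, rfl, by simp⟩, by simp [mul_comm]⟩

theorem index_latticeExtension {c : ℕ} (hc : c ≠ 0) (L : AddSubgroup A) (q : A ⧸ L) :
    (latticeExtension (c : ℤ) L q).index = L.index * c := by
  rw [index_eq_index_comap_inl_mul_index_map_snd, map_snd_latticeExtension,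
    comap_inl_latticeExtension (by exact_mod_cast hc), Int.index_zmultiples, Int.natAbs_natCast]

theorem mk_mem_latticeExtension {c : ℤ} (hc : c ≠ 0) {L : AddSubgroup A} {q : A ⧸ L} {v : A} :
    (v, c) ∈ latticeExtension c L q ↔ (v : A ⧸ L) = q := by
  rw [mem_latticeExtension]
  constructor
  · rintro ⟨j, hj, hq⟩
    obtain rfl : j = 1 := by simpa [hc] using hj.symm
    simpa using hq
  · intro h
    exact ⟨1, by simp, by simpa using h⟩

theorem exists_eq_latticeExtension (L : AddSubgroup (A × ℤ)) :
    ∃ q : A ⧸ L.comap (AddMonoidHom.inl A ℤ),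
      latticeExtension ((L.map (AddMonoidHom.snd A ℤ)).index : ℤ) _ q = L := by
  set c := (L.map (AddMonoidHom.snd A ℤ)).index
  have hmap : L.map (AddMonoidHom.snd A ℤ) = zmultiples (c : ℤ) := eq_zmultiples_index _
  obtain ⟨⟨v, k⟩, hv, rfl : k = c⟩ : (c : ℤ) ∈ L.map (AddMonoidHom.snd A ℤ) := by
    rw [hmap]; exact mem_zmultiples _
  refine ⟨(v : A ⧸ _), ?_⟩
  have key (a : A) (j : ℤ) : (a : A ⧸ L.comap (AddMonoidHom.inl A ℤ)) = j • (v : A ⧸ _) ↔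
      (a, (c : ℤ) * j) ∈ L := by
    rw [← QuotientAddGroup.mk_zsmul, eq_comm, QuotientAddGroup.eq, mem_comap,
      ← L.add_mem_cancel_left (L.zsmul_mem hv j)]
    simp [mul_comm]
  ext ⟨a, k⟩
  simp only [mem_latticeExtension, key]
  constructor
  · rintro ⟨j, rfl, h⟩
    exact h
  · intro h
    have : k ∈ L.map (AddMonoidHom.snd A ℤ) := ⟨_, h, rfl⟩
    rw [hmap, mem_zmultiples_iff] at this
    obtain ⟨j, rfl⟩ := this
    exact ⟨j, by simp [mul_comm], by simpa [mul_comm] using h⟩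

/-- Sending `(c, L, q)` to `latticeExtension c L q` parametrizes the subgroups of `A × ℤ` of
index `m`. -/
theorem bijective_latticeExtension {m : ℕ} (hm : m ≠ 0) :
    Function.Bijective (fun t : Σ p : m.divisorsAntidiagonal,
      Σ L : {L : AddSubgroup A // L.index = p.1.1}, A ⧸ L.1 ↦
      (⟨latticeExtension (t.1.1.2 : ℤ) t.2.1.1 t.2.2, by
        have hp := Nat.mem_divisorsAntidiagonal.1 t.1.2
        rw [index_latticeExtension (right_ne_zero_of_mul (hp.1.trans_ne hm)), t.2.1.2, hp.1]⟩ :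
        {L : AddSubgroup (A × ℤ) // L.index = m})) := by
  constructor
  · rintro ⟨⟨⟨d, c⟩, hp⟩, ⟨L, hL⟩, q⟩ ⟨⟨⟨d', c'⟩, hp'⟩, ⟨L', hL'⟩, q'⟩ h
    have hcd := hp
    have hcd' := hp'
    rw [Nat.mem_divisorsAntidiagonal] at hcd hcd'
    have hc : (c : ℤ) ≠ 0 := by exact_mod_cast right_ne_zero_of_mul (hcd.1.trans_ne hm)
    have hc' : (c' : ℤ) ≠ 0 := by exact_mod_cast right_ne_zero_of_mul (hcd'.1.trans_ne hm)
    replace h : latticeExtension (c : ℤ) L q = latticeExtension (c' : ℤ) L' q' :=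
      congrArg Subtype.val h
    obtain rfl : L = L' := by
      rw [← comap_inl_latticeExtension hc L q, h, comap_inl_latticeExtension hc']
    obtain rfl : d = d' := hL.symm.trans hL'
    obtain rfl : c = c' := by
      have := congrArg (fun K => (K.map (AddMonoidHom.snd A ℤ)).index) h
      simpa [map_snd_latticeExtension, Int.index_zmultiples] using this
    obtain rfl : q = q' := by
      obtain ⟨v, rfl⟩ := QuotientAddGroup.mk_surjective q
      exact (mk_mem_latticeExtension hc).1 (h ▸ (mk_mem_latticeExtension hc).2 rfl)
    rfl
  · rintro ⟨L, rfl⟩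
    obtain ⟨q, hq⟩ := exists_eq_latticeExtension L
    exact ⟨⟨⟨(_, _), Nat.mem_divisorsAntidiagonal.2
      ⟨(index_eq_index_comap_inl_mul_index_map_snd L).symm, hm⟩⟩, ⟨_, rfl⟩, q⟩, Subtype.ext hq⟩

theorem finite_index_eq_prod_int (hA : ∀ d ≠ 0, Finite {L : AddSubgroup A // L.index = d})
    {m : ℕ} (hm : m ≠ 0) : Finite {L : AddSubgroup (A × ℤ) // L.index = m} := by
  have (p : m.divisorsAntidiagonal) : Finite {L : AddSubgroup A // L.index = p.1.1} :=
    hA _ (Nat.ne_zero_of_mem_divisorsAntidiagonal p.2).1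
  have (p : m.divisorsAntidiagonal) (L : {L : AddSubgroup A // L.index = p.1.1}) :
      Finite (A ⧸ L.1) :=
    Nat.finite_of_card_ne_zero (L.2.trans_ne (Nat.ne_zero_of_mem_divisorsAntidiagonal p.2).1)
  exact Finite.of_surjective _ (bijective_latticeExtension hm).2

theorem card_index_eq_prod_int (hA : ∀ d ≠ 0, Finite {L : AddSubgroup A // L.index = d})
    {m : ℕ} (hm : m ≠ 0) :
    Nat.card {L : AddSubgroup (A × ℤ) // L.index = m} =
      ∑ p ∈ m.divisorsAntidiagonal, Nat.card {L : AddSubgroup A // L.index = p.1} * p.1 := by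
  have (p : m.divisorsAntidiagonal) : Finite {L : AddSubgroup A // L.index = p.1.1} :=
    hA _ (Nat.ne_zero_of_mem_divisorsAntidiagonal p.2).1
  have (p : m.divisorsAntidiagonal) (L : {L : AddSubgroup A // L.index = p.1.1}) :
      Finite (A ⧸ L.1) :=
    Nat.finite_of_card_ne_zero (L.2.trans_ne (Nat.ne_zero_of_mem_divisorsAntidiagonal p.2).1)
  rw [← Nat.card_congr (Equiv.ofBijective _ (bijective_latticeExtension hm)), Nat.card_sigma,
    ← Finset.sum_coe_sort m.divisorsAntidiagonal fun p ↦
      Nat.card {L : AddSubgroup A // L.index = p.1} * p.1]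
  refine Finset.sum_congr rfl fun p _ ↦ ?_
  have := Fintype.ofFinite {L : AddSubgroup A // L.index = p.1.1}
  rw [Nat.card_sigma, Nat.card_eq_fintype_card, ← Finset.card_univ]
  exact Finset.sum_const_nat fun L _ ↦ L.2

theorem card_int_index_eq (d : ℕ) : Nat.card {L : AddSubgroup ℤ // L.index = d} = 1 := by
  rw [Nat.card_eq_one_iff_unique]
  refine ⟨⟨?_⟩, ⟨⟨zmultiples (d : ℤ), by simp [Int.index_zmultiples]⟩⟩⟩
  rintro ⟨L, rfl⟩ ⟨L', h⟩
  exact Subtype.ext (by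
    conv_lhs => rw [eq_zmultiples_index L, ← h, ← eq_zmultiples_index L'])

/-- The number of sublattices of index `m` in `ℤ³`. -/
theorem card_int_prod_index_eq {m : ℕ} (hm : m ≠ 0) :
    Nat.card {L : AddSubgroup ((ℤ × ℤ) × ℤ) // L.index = m} =
      ∑ p ∈ m.divisorsAntidiagonal, (∑ q ∈ p.1.divisorsAntidiagonal, q.1) * p.1 := by
  have h₁ (d : ℕ) (_ : d ≠ 0) : Finite {L : AddSubgroup ℤ // L.index = d} :=
    Nat.finite_of_card_ne_zero (by simp [card_int_index_eq])
  rw [card_index_eq_prod_int (fun d hd ↦ finite_index_eq_prod_int h₁ hd) hm]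
  refine Finset.sum_congr rfl fun p hp ↦ ?_
  rw [card_index_eq_prod_int h₁ (Nat.ne_zero_of_mem_divisorsAntidiagonal hp).1]
  simp [card_int_index_eq]

end AddSubgroup

theorem sum_divisorsAntidiagonal_eq_omegaFn {m : ℕ} (hm : m ≠ 0) :
    ∑ p ∈ m.divisorsAntidiagonal, (∑ q ∈ p.1.divisorsAntidiagonal, q.1) * p.1 = omegaFn m := by
  simp_rw [Finset.sum_mul]
  rw [Finset.sum_sigma', omegaFn]
  refine Finset.sum_bij' (fun x _ ↦ (x.2.1, x.2.2, x.1.2))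
    (fun t _ ↦ ⟨(t.1 * t.2.1, t.2.2), (t.1, t.2.1)⟩) ?_ ?_ ?_ ?_ ?_
  · rintro ⟨⟨e, c⟩, a, b⟩ h
    simp only [Finset.mem_sigma, Nat.mem_divisorsAntidiagonal] at h
    obtain ⟨⟨rfl, -⟩, rfl, -⟩ := h
    have hdvd {x : ℕ} (hx : x ∣ a * b * c) : x < a * b * c + 1 :=
      Nat.lt_succ_of_le (Nat.le_of_dvd (Nat.pos_of_ne_zero hm) hx)
    simp only [ne_eq, mul_eq_zero, not_or] at hm
    simp only [Finset.mem_filter, Finset.mem_product, Finset.mem_range, and_true]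
    exact ⟨⟨hdvd ⟨b * c, by ring⟩, hdvd ⟨a * c, by ring⟩, hdvd ⟨a * b, by ring⟩⟩,
      Nat.pos_of_ne_zero hm.1.1, Nat.pos_of_ne_zero hm.1.2, Nat.pos_of_ne_zero hm.2⟩
  · rintro ⟨a, b, c⟩ h
    obtain ⟨-, ha, hb, -, h⟩ := Finset.mem_filter.1 h
    simp only [Finset.mem_sigma, Nat.mem_divisorsAntidiagonal]
    exact ⟨⟨h, hm⟩, trivial, (Nat.mul_pos ha hb).ne'⟩
  · rintro ⟨⟨e, c⟩, a, b⟩ h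
    simp only [Finset.mem_sigma, Nat.mem_divisorsAntidiagonal] at h
    obtain ⟨-, rfl, -⟩ := h
    rfl
  · intros
    rfl
  · rintro ⟨⟨e, c⟩, a, b⟩ h
    simp only [Finset.mem_sigma, Nat.mem_divisorsAntidiagonal] at h
    obtain ⟨-, rfl, -⟩ := h
    ring

/-- If the generators `s` of `G` conjugate `t` to `t ^ ε s`, so do all elements of `G`. -/
theorem conj_eq_zpow_of_closure_eq_top {G : Type*} [Group G] {S : Set G}
    (hS : Subgroup.closure S = ⊤) (ε : G →* ℤˣ) (t : G)
    (h : ∀ s ∈ S, s * t * s⁻¹ = t ^ (ε s : ℤ)) (g : G) : g * t * g⁻¹ = t ^ (ε g : ℤ) := by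
  have hg : g ∈ Subgroup.closure S := hS ▸ Subgroup.mem_top g
  induction hg using Subgroup.closure_induction with
  | mem s hs => exact h s hs
  | one => simp
  | mul a b _ _ ha hb =>
    rw [map_mul, Units.val_mul, zpow_mul, ← ha, conj_zpow, ← hb]
    group
  | inv a _ ha =>
    have h2 : (t ^ (ε a : ℤ)) ^ (ε a : ℤ) = t := by
      rw [← zpow_mul, ← Units.val_mul, Int.units_mul_self, Units.val_one, zpow_one]
    rw [map_inv, Int.units_inv_eq_self]
    nth_rw 1 [← h2]
    rw [← ha, conj_zpow, ha]
    group

theorem hwx_mul_hwy_mul_hwz : hwx * hwy * hwz = 1 :=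
  PresentedGroup.one_of_mem (rels := hwRels) (by simp [hwRels])

theorem hwx_conj_hwy_sq : hwx * hwy ^ 2 * hwx⁻¹ = (hwy ^ 2)⁻¹ :=
  eq_inv_of_mul_eq_one_left <| PresentedGroup.one_of_mem (rels := hwRels) (by simp [hwRels])

theorem hwy_conj_hwx_sq : hwy * hwx ^ 2 * hwy⁻¹ = (hwx ^ 2)⁻¹ :=
  eq_inv_of_mul_eq_one_left <| PresentedGroup.one_of_mem (rels := hwRels) (by simp [hwRels])

theorem hwz_eq : hwz = (hwx * hwy)⁻¹ := eq_inv_of_mul_eq_one_right hwx_mul_hwy_mul_hwz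

theorem hw_closure : Subgroup.closure {hwx, hwy} = ⊤ := by
  rw [eq_top_iff, ← PresentedGroup.closure_range_of hwRels, Subgroup.closure_le]
  have hx : hwx ∈ Subgroup.closure {hwx, hwy} := Subgroup.subset_closure (by simp)
  have hy : hwy ∈ Subgroup.closure {hwx, hwy} := Subgroup.subset_closure (by simp)
  rintro _ ⟨i, rfl⟩
  fin_cases i
  · exact hx
  · exact hy
  · change hwz ∈ _
    rw [hwz_eq]
    exact inv_mem (mul_mem hx hy)

/-- The homomorphism out of the Hantzsche–Wendt group determined by the images of `x` and `y`. -/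
def hwLift {G : Type*} [Group G] (a b : G) (hab : a * b ^ 2 * a⁻¹ * b ^ 2 = 1)
  (hba : b * a ^ 2 * b⁻¹ * a ^ 2 = 1) : HW →* G :=
  PresentedGroup.toGroup (rels := hwRels) (f := ![a, b, (a * b)⁻¹]) <| by
    rintro r (rfl | rfl | rfl) <;> simp [hab, hba]

section hwLift

variable {G : Type*} [Group G] {a b : G} (hab : a * b ^ 2 * a⁻¹ * b ^ 2 = 1)
  (hba : b * a ^ 2 * b⁻¹ * a ^ 2 = 1)

@[simp]
theorem hwLift_hwx : hwLift a b hab hba hwx = a := PresentedGroup.toGroup.of _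

@[simp]
theorem hwLift_hwy : hwLift a b hab hba hwy = b := PresentedGroup.toGroup.of _

end hwLift

/-- The characters of `HW` by which it acts, by conjugation, on `x²` and on `y²`. -/
def hwSign : HW →* ℤˣ × ℤˣ := hwLift (1, -1) (-1, 1) (by decide) (by decide)

theorem hw_conj_hwx_sq (g : HW) : g * hwx ^ 2 * g⁻¹ = (hwx ^ 2) ^ ((hwSign g).1 : ℤ) := by
  refine conj_eq_zpow_of_closure_eq_top hw_closure ((MonoidHom.fst _ _).comp hwSign) _ ?_ g
  rintro _ (rfl | rfl)
  · simp [hwSign]; group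
  · simp [hwSign, hwy_conj_hwx_sq]

theorem hw_conj_hwy_sq (g : HW) : g * hwy ^ 2 * g⁻¹ = (hwy ^ 2) ^ ((hwSign g).2 : ℤ) := by
  refine conj_eq_zpow_of_closure_eq_top hw_closure ((MonoidHom.snd _ _).comp hwSign) _ ?_ g
  rintro _ (rfl | rfl)
  · simp [hwSign, hwx_conj_hwy_sq]
  · simp [hwSign]; group

theorem hwx_conj_hwz_sq : hwx * hwz ^ 2 * hwx⁻¹ = (hwz ^ 2)⁻¹ := by
  rw [hwz_eq, eq_inv_iff_mul_eq_one, ← inv_eq_one, inv_pow]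
  have h := hw_conj_hwy_sq hwx⁻¹
  simp only [inv_inv, map_inv, hwSign, hwLift_hwx, Prod.snd_inv, Int.units_inv_eq_self,
    Units.val_neg, Units.val_one, zpow_neg_one] at h
  calc _ = hwx * hwy * hwx * (hwy * hwx ^ 2 * hwy⁻¹) * hwy ^ 2 * hwx * hwy * hwx⁻¹ := by simp [pow_two, mul_assoc]
    _ = hwx * hwy * (hwx⁻¹ * hwy ^ 2 * hwx) * hwy * hwx⁻¹ := by
      rw [hwy_conj_hwx_sq]; group
    _ = 1 := by rw [h]; group

theorem hwy_conj_hwz_sq : hwy * hwz ^ 2 * hwy⁻¹ = (hwz ^ 2)⁻¹ := by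
  rw [hwz_eq, eq_inv_iff_mul_eq_one, ← inv_eq_one, inv_pow]
  have h := hw_conj_hwx_sq hwy⁻¹
  simp only [inv_inv, map_inv, hwSign, hwLift_hwy, Prod.fst_inv, Int.units_inv_eq_self,
    Units.val_neg, Units.val_one, zpow_neg_one] at h
  calc _ = hwx * hwy * (hwx * hwy ^ 2 * hwx⁻¹) * hwx ^ 2 * hwy * hwx := by simp [pow_two, mul_assoc]
    _ = hwx * (hwy⁻¹ * hwx ^ 2 * hwy) * hwx := by
      rw [hwx_conj_hwy_sq]; group
    _ = 1 := by rw [h]; group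

theorem hw_conj_hwz_sq (g : HW) :
    g * hwz ^ 2 * g⁻¹ = (hwz ^ 2) ^ ((hwSign g).1 * (hwSign g).2 : ℤ) := by
  rw [← Units.val_mul]
  refine conj_eq_zpow_of_closure_eq_top hw_closure
    ((MonoidHom.fst _ _).comp hwSign * (MonoidHom.snd _ _).comp hwSign) _ ?_ g
  rintro _ (rfl | rfl)
  · simp [hwSign, hwx_conj_hwz_sq]
  · simp [hwSign, hwy_conj_hwz_sq]

/-- The action of `x` on the lattice `½ℤ³`, rescaled to `ℤ³`. -/
def hwActX : Equiv.Perm (ℤ × ℤ × ℤ) where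
  toFun v := (v.1 + 1, -v.2.1, 1 - v.2.2)
  invFun v := (v.1 - 1, -v.2.1, 1 - v.2.2)
  left_inv v := by simp
  right_inv v := by simp

/-- The action of `y` on the lattice `½ℤ³`, rescaled to `ℤ³`. -/
def hwActY : Equiv.Perm (ℤ × ℤ × ℤ) where
  toFun v := (-v.1, v.2.1 + 1, -v.2.2)
  invFun v := (-v.1, v.2.1 - 1, -v.2.2)
  left_inv v := by simp
  right_inv v := by simp

/-- The action of `HW` on `ℤ³` by crystallographic motions. -/
def hwAct : HW →* Equiv.Perm (ℤ × ℤ × ℤ) := hwLift hwActX hwActY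
  (by ext v : 1; simp [hwActX, hwActY, pow_two, Equiv.Perm.inv_def])
  (by ext v : 1; simp [hwActX, hwActY, pow_two, Equiv.Perm.inv_def])

theorem hwAct_hwx_sq : hwAct (hwx ^ 2) = Equiv.addLeft (2, 0, 0) := by
  ext v : 1
  simp [hwAct, hwActX, pow_two, Prod.ext_iff]
  ring

theorem hwAct_hwy_sq : hwAct (hwy ^ 2) = Equiv.addLeft (0, 2, 0) := by
  ext v : 1
  simp [hwAct, hwActY, pow_two, Prod.ext_iff]
  ring

theorem hwAct_hwz_sq : hwAct (hwz ^ 2) = Equiv.addLeft (0, 0, -2) := by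
  ext v : 1
  simp [hwz_eq, hwAct, hwActX, hwActY, pow_two, Prod.ext_iff, Equiv.Perm.inv_def]
  ring

theorem hwSign_hwx_sq : hwSign (hwx ^ 2) = 1 := by simp [hwSign]

theorem hwSign_hwy_sq : hwSign (hwy ^ 2) = 1 := by simp [hwSign]

theorem hwSign_hwz_sq : hwSign (hwz ^ 2) = 1 := by simp [hwSign, hwz_eq]

theorem hw_commute_hwx_sq_hwy_sq : Commute (hwx ^ 2) (hwy ^ 2) := by
  have h := hw_conj_hwy_sq (hwx ^ 2)
  rw [hwSign_hwx_sq] at h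
  exact mul_inv_eq_iff_eq_mul.1 (by simpa using h)

theorem hw_commute_hwx_sq_hwz_sq : Commute (hwx ^ 2) (hwz ^ 2) := by
  have h := hw_conj_hwz_sq (hwx ^ 2)
  rw [hwSign_hwx_sq] at h
  exact mul_inv_eq_iff_eq_mul.1 (by simpa using h)

theorem hw_commute_hwy_sq_hwz_sq : Commute (hwy ^ 2) (hwz ^ 2) := by
  have h := hw_conj_hwz_sq (hwy ^ 2)
  rw [hwSign_hwy_sq] at h
  exact mul_inv_eq_iff_eq_mul.1 (by simpa using h)

/-- The translation lattice `⟨x², y², z²⟩` of `HW`, as a homomorphism from `ℤ³`. -/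
def hwTranslation : Multiplicative ((ℤ × ℤ) × ℤ) →* HW where
  toFun m := (hwx ^ 2) ^ m.toAdd.1.1 * (hwy ^ 2) ^ m.toAdd.1.2 * (hwz ^ 2) ^ m.toAdd.2
  map_one' := by simp
  map_mul' m m' := by
    simp only [toAdd_mul, Prod.fst_add, Prod.snd_add, zpow_add]
    have hxy := hw_commute_hwx_sq_hwy_sq.zpow_zpow m'.toAdd.1.1 m.toAdd.1.2
    have hxz := hw_commute_hwx_sq_hwz_sq.zpow_zpow m'.toAdd.1.1 m.toAdd.2
    have hyz := hw_commute_hwy_sq_hwz_sq.zpow_zpow m'.toAdd.1.2 m.toAdd.2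
    rw [(hxy.mul_mul_mul_comm _ _), mul_assoc, mul_assoc,
      ← ((hxz.mul_left hyz).mul_mul_mul_comm _ _)]
    simp only [mul_assoc]

theorem hwTranslation_apply (m : Multiplicative ((ℤ × ℤ) × ℤ)) : hwTranslation m =
    (hwx ^ 2) ^ m.toAdd.1.1 * (hwy ^ 2) ^ m.toAdd.1.2 * (hwz ^ 2) ^ m.toAdd.2 := rfl

theorem hwTranslation_injective : Function.Injective hwTranslation := by
  intro m m' h
  replace h := congrArg (fun g ↦ hwAct g 0) h
  simp only [hwTranslation_apply, map_mul, map_zpow, hwAct_hwx_sq, hwAct_hwy_sq, hwAct_hwz_sq] at h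
  obtain ⟨h₁, h₂, h₃⟩ : m.toAdd.1.1 = m'.toAdd.1.1 ∧ m.toAdd.1.2 = m'.toAdd.1.2 ∧
      m.toAdd.2 = m'.toAdd.2 := by simpa [Prod.ext_iff] using h
  exact Multiplicative.toAdd.injective (Prod.ext (Prod.ext h₁ h₂) h₃)

instance hwTranslation_range_normal : hwTranslation.range.Normal := by
  refine ⟨?_⟩
  rintro _ ⟨m, rfl⟩ g
  refine ⟨.ofAdd (((hwSign g).1 * m.toAdd.1.1, (hwSign g).2 * m.toAdd.1.2),
    ((hwSign g).1 * (hwSign g).2 * m.toAdd.2)), ?_⟩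
  simp only [hwTranslation_apply, toAdd_ofAdd, zpow_mul (hwx ^ 2), zpow_mul (hwy ^ 2),
    zpow_mul (hwz ^ 2) _ m.toAdd.2, ← hw_conj_hwx_sq, ← hw_conj_hwy_sq, ← hw_conj_hwz_sq, conj_zpow]
  group

theorem hwTranslation_range_le : hwTranslation.range ≤ hwSign.ker := by
  rintro _ ⟨m, rfl⟩
  simp only [MonoidHom.mem_ker, hwTranslation_apply, map_mul, map_zpow, hwSign_hwx_sq,
    hwSign_hwy_sq, hwSign_hwz_sq, one_zpow, mul_one]

/-- A group generated by two commuting involutions has at most four elements. -/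
theorem mem_klein_of_closure_eq_top {G : Type*} [Group G] {a b : G}
    (h : Subgroup.closure {a, b} = ⊤) (ha : a * a = 1) (hb : b * b = 1)
    (hab : a * b * (a * b) = 1) (g : G) : g = 1 ∨ g = a ∨ g = b ∨ g = a * b := by
  have ha' : a⁻¹ = a := inv_eq_of_mul_eq_one_left ha
  have hb' : b⁻¹ = b := inv_eq_of_mul_eq_one_left hb
  have hba : b * a = a * b := by
    rw [← inv_eq_of_mul_eq_one_left hab, mul_inv_rev, ha', hb']
  have haab : a * (a * b) = b := by rw [← mul_assoc, ha, one_mul]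
  have hbab : b * (a * b) = a := by rw [← hba, ← mul_assoc, hb, one_mul]
  have hmul (s : G) (hs : s = a ∨ s = b) (g : G) (hg : g = 1 ∨ g = a ∨ g = b ∨ g = a * b) :
      s * g = 1 ∨ s * g = a ∨ s * g = b ∨ s * g = a * b := by
    rcases hs with rfl | rfl <;> rcases hg with rfl | rfl | rfl | rfl <;>
      simp only [mul_one, ha, hb, hba, haab, hbab, true_or, or_true]
  have hg : g ∈ Subgroup.closure {a, b} := h ▸ Subgroup.mem_top g
  induction hg using Subgroup.closure_induction_left with
  | one => exact Or.inl rfl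
  | mul_left s hs g _ ih => exact hmul s hs g ih
  | inv_mul_cancel s hs g _ ih =>
    refine hmul s⁻¹ ?_ g ih
    rcases hs with rfl | rfl
    · exact Or.inl ha'
    · exact Or.inr hb'

theorem hw_mk_eq (g : HW) : (g : HW ⧸ hwTranslation.range) = 1 ∨
    (g : HW ⧸ hwTranslation.range) = hwx ∨ (g : HW ⧸ hwTranslation.range) = hwy ∨
    (g : HW ⧸ hwTranslation.range) = (hwx * hwy : HW) := by
  refine mem_klein_of_closure_eq_top ?_ ?_ ?_ ?_ _
  · have := congrArg (Subgroup.map (QuotientGroup.mk' hwTranslation.range)) hw_closure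
    rwa [MonoidHom.map_closure, Set.image_pair, Subgroup.map_top_of_surjective _
      (QuotientGroup.mk'_surjective _)] at this
  · rw [← QuotientGroup.mk_mul, QuotientGroup.eq_one_iff]
    exact ⟨.ofAdd ((1, 0), 0), by simp [hwTranslation_apply, pow_two]⟩
  · rw [← QuotientGroup.mk_mul, QuotientGroup.eq_one_iff]
    exact ⟨.ofAdd ((0, 1), 0), by simp [hwTranslation_apply, pow_two]⟩
  · rw [← QuotientGroup.mk_mul, ← QuotientGroup.mk_mul, QuotientGroup.eq_one_iff]
    exact ⟨.ofAdd ((0, 0), -1), by simp [hwTranslation_apply, hwz_eq, pow_two]⟩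

/-- The translation lattice consists of the elements acting trivially on it by conjugation. -/
theorem hwTranslation_range : hwTranslation.range = hwSign.ker := by
  refine hwTranslation_range_le.antisymm fun g hg ↦ ?_
  have key {r : HW} (h : (g : HW ⧸ hwTranslation.range) = r) : hwSign r = 1 := by
    have := hwTranslation_range_le (QuotientGroup.eq.1 h)
    rwa [MonoidHom.mem_ker, map_mul, map_inv, MonoidHom.mem_ker.1 hg, inv_one, one_mul] at this
  rcases hw_mk_eq g with h | h | h | h
  · rwa [QuotientGroup.eq_one_iff] at h
  all_goals exact absurd (key h) (by simp [hwSign])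

theorem hwSign_surjective : Function.Surjective hwSign := by
  rintro ⟨u, v⟩
  rcases Int.units_eq_one_or u with rfl | rfl <;> rcases Int.units_eq_one_or v with rfl | rfl
  · exact ⟨1, map_one _⟩
  · exact ⟨hwx, by simp [hwSign]⟩
  · exact ⟨hwy, by simp [hwSign]⟩
  · exact ⟨hwx * hwy, by simp [hwSign]⟩

theorem index_hwTranslation_range : hwTranslation.range.index = 4 := by
  rw [hwTranslation_range, Subgroup.index_ker,
    MonoidHom.range_eq_top_of_surjective _ hwSign_surjective, Subgroup.card_top,
    Nat.card_eq_fintype_card]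
  rfl

/-- An element of a commutative finite-index subgroup cannot invert an element of infinite order. -/
theorem eq_one_of_conj_eq_zpow_units {G : Type*} [Group G] {t g : G}
    (ht : Function.Injective fun k : ℤ ↦ t ^ k) {e : ℤˣ} (hg : g * t * g⁻¹ = t ^ (e : ℤ))
    {H : Subgroup G} (hH : H.index ≠ 0) (hcomm : ∀ a ∈ H, ∀ b ∈ H, a * b = b * a) (hgH : g ∈ H) :
    e = 1 := by
  obtain ⟨k, hk, -, hmem⟩ := Subgroup.exists_pow_mem_of_index_ne_zero hH t
  have h : t ^ (k : ℤ) = t ^ (e * k : ℤ) := by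
    rw [zpow_mul, ← hg, conj_zpow, zpow_natCast, hcomm _ hgH _ hmem, mul_inv_cancel_right]
  have h' := ht h
  have hk' : (k : ℤ) ≠ 0 := by exact_mod_cast hk.ne'
  exact Units.ext ((mul_eq_right₀ hk').1 h'.symm)

theorem zpow_hwx_sq_injective : Function.Injective fun k : ℤ ↦ (hwx ^ 2) ^ k := by
  intro k l h
  have := @hwTranslation_injective (.ofAdd ((k, 0), 0)) (.ofAdd ((l, 0), 0))
    (by simpa [hwTranslation_apply] using h)
  simpa using this

theorem zpow_hwy_sq_injective : Function.Injective fun k : ℤ ↦ (hwy ^ 2) ^ k := by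
  intro k l h
  have := @hwTranslation_injective (.ofAdd ((0, k), 0)) (.ofAdd ((0, l), 0))
    (by simpa [hwTranslation_apply] using h)
  simpa using this

/-- Every commutative finite-index subgroup of `HW` lies in the translation lattice. -/
theorem le_hwTranslation_range {H : Subgroup HW} (hH : H.index ≠ 0)
    (hcomm : ∀ a ∈ H, ∀ b ∈ H, a * b = b * a) : H ≤ hwTranslation.range := by
  intro g hg
  rw [hwTranslation_range, MonoidHom.mem_ker]
  exact Prod.ext
    (eq_one_of_conj_eq_zpow_units zpow_hwx_sq_injective (hw_conj_hwx_sq g) hH hcomm hg)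
    (eq_one_of_conj_eq_zpow_units zpow_hwy_sq_injective (hw_conj_hwy_sq g) hH hcomm hg)

theorem AddSubgroup.nonempty_addEquiv_of_index_ne_zero {A B : Type*} [AddCommGroup A]
    [AddCommGroup B] [Module.Free ℤ A] [Module.Finite ℤ A] [Module.Free ℤ B] [Module.Finite ℤ B]
    (h : Module.finrank ℤ A = Module.finrank ℤ B) {L : AddSubgroup A} (hL : L.index ≠ 0) :
    Nonempty (L ≃+ B) := by
  have : Finite (A ⧸ L.toIntSubmodule) := Nat.finite_of_card_ne_zero hL
  have e : L.toIntSubmodule ≃ₗ[ℤ] B := LinearEquiv.ofFinrankEq _ _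
    (((Submodule.finiteQuotient_iff _).1 this).trans h)
  exact ⟨e.toAddEquiv⟩

theorem index_map_hwTranslation (L : AddSubgroup ((ℤ × ℤ) × ℤ)) :
    (L.toSubgroup.map hwTranslation).index = L.index * 4 := by
  rw [Subgroup.index_map_of_injective _ hwTranslation_injective, index_hwTranslation_range,
    AddSubgroup.index_toSubgroup]

theorem nonempty_mulEquiv_map_hwTranslation {L : AddSubgroup ((ℤ × ℤ) × ℤ)} (hL : L.index ≠ 0) :
    Nonempty (L.toSubgroup.map hwTranslation ≃* Multiplicative (ℤ × ℤ × ℤ)) := by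
  obtain ⟨e⟩ := AddSubgroup.nonempty_addEquiv_of_index_ne_zero (B := ℤ × ℤ × ℤ) (by simp) hL
  exact ⟨(L.toSubgroup.equivMapOfInjective _ hwTranslation_injective).symm.trans
    (AddEquiv.toMultiplicative e)⟩

theorem exists_eq_map_hwTranslation {H : Subgroup HW} (hH : H.index ≠ 0)
    (hiso : Nonempty (H ≃* Multiplicative (ℤ × ℤ × ℤ))) :
    ∃ L : AddSubgroup ((ℤ × ℤ) × ℤ), L.toSubgroup.map hwTranslation = H := by
  obtain ⟨e⟩ := hiso
  have hcomm (a) (ha : a ∈ H) (b) (hb : b ∈ H) : a * b = b * a :=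
    congrArg Subtype.val (e.injective (a₁ := ⟨a, ha⟩ * ⟨b, hb⟩) (a₂ := ⟨b, hb⟩ * ⟨a, ha⟩)
      (by rw [map_mul, map_mul, mul_comm]))
  refine ⟨AddSubgroup.toSubgroup.symm (H.comap hwTranslation), ?_⟩
  rw [OrderIso.apply_symm_apply, Subgroup.map_comap_eq_self (le_hwTranslation_range hH hcomm)]

theorem card_subgroup_hw_eq_card_addSubgroup {m : ℕ} (hm : m ≠ 0) :
    Nat.card {H : Subgroup HW //
        H.index = m * 4 ∧ Nonempty (H ≃* Multiplicative (ℤ × ℤ × ℤ))} =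
      Nat.card {L : AddSubgroup ((ℤ × ℤ) × ℤ) // L.index = m} := by
  symm
  refine Nat.card_congr (Equiv.ofBijective (fun L ↦ ⟨L.1.toSubgroup.map hwTranslation,
    by rw [index_map_hwTranslation, L.2],
    nonempty_mulEquiv_map_hwTranslation (L.2.trans_ne hm)⟩) ⟨?_, ?_⟩)
  · intro L L' h
    exact Subtype.ext (AddSubgroup.toSubgroup.injective
      (Subgroup.map_injective hwTranslation_injective (congrArg Subtype.val h)))
  · rintro ⟨H, hH, hiso⟩
    obtain ⟨L, rfl⟩ := exists_eq_map_hwTranslation (hH.trans_ne (by simpa)) hiso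
    rw [index_map_hwTranslation] at hH
    exact ⟨⟨L, Nat.eq_of_mul_eq_mul_right (by simp) hH⟩, rfl⟩

theorem stmt11 (n : ℕ) (hn : 0 < n) :
    Nat.card {H : Subgroup HW //
        H.index = n ∧ Nonempty (H ≃* Multiplicative (ℤ × ℤ × ℤ))} =
      if 4 ∣ n then omegaFn (n / 4) else 0 := by
  split_ifs with h
  · obtain ⟨m, rfl⟩ := h
    have hm : m ≠ 0 := by rintro rfl; simp at hn
    rw [Nat.mul_div_cancel_left m four_pos, mul_comm, card_subgroup_hw_eq_card_addSubgroup hm,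
      AddSubgroup.card_int_prod_index_eq hm, sum_divisorsAntidiagonal_eq_omegaFn hm]
  · have : IsEmpty {H : Subgroup HW //
        H.index = n ∧ Nonempty (H ≃* Multiplicative (ℤ × ℤ × ℤ))} := by
      refine ⟨fun ⟨H, hH, hiso⟩ ↦ h ?_⟩
      obtain ⟨L, rfl⟩ := exists_eq_map_hwTranslation (hH.trans_ne hn.ne') hiso
      exact ⟨L.index, by rw [← hH, index_map_hwTranslation, mul_comm]⟩
    exact Nat.card_of_isEmpty
end

section
/- The number of subgroups of index n in π₁(𝒢₆) that are isomorphic to π₁(𝒢₆) itself equals n·(d_3(n) - 3d_3(n/2) + 3d_3(n/4) - d_3(n/8)); equivalently, it equals n·d_3(n) if n is odd and 0 if n is even. -/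
/-- `d3 n` = number of ordered triples `(a,b,c)` of positive integers with `a*b*c = n`. -/
def d3 (n : ℕ) : ℕ :=
  ((Finset.range (n+1) ×ˢ Finset.range (n+1) ×ˢ Finset.range (n+1)).filter
    (fun t => 0 < t.1 ∧ 0 < t.2.1 ∧ 0 < t.2.2 ∧ t.1 * t.2.1 * t.2.2 = n)).card

/-- `d3If n k` = `d3 (n / k)` if `k ∣ n`, and `0` otherwise. -/
def d3If (n k : ℕ) : ℕ := if k ∣ n then d3 (n / k) else 0

namespace HantzscheWendt

/-- The sign `(-1) ^ c`. -/
def sgn (c : ℤ) : ℤ := 1 - 2 * (c % 2)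

lemma sgn_of_even {c : ℤ} (h : c % 2 = 0) : sgn c = 1 := by simp [sgn, h]

lemma sgn_of_odd {c : ℤ} (h : c % 2 = 1) : sgn c = -1 := by simp [sgn, h]

@[simp] lemma sgn_zero : sgn 0 = 1 := by simp [sgn]

lemma sgn_two_mul (c : ℤ) : sgn (2 * c) = 1 := sgn_of_even (by omega)

lemma sgn_eq (c : ℤ) : c % 2 = 0 ∧ sgn c = 1 ∨ c % 2 = 1 ∧ sgn c = -1 := by
  unfold sgn; omega

lemma sgn_mul_self (c : ℤ) : sgn c * sgn c = 1 := by
  rcases sgn_eq c with ⟨-, h⟩ | ⟨-, h⟩ <;> simp [h]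

lemma add_sgn_mul_emod_two (a b c : ℤ) : (a + sgn b * c) % 2 = (a + c) % 2 := by
  rcases sgn_eq b with ⟨-, h⟩ | ⟨-, h⟩ <;> rw [h] <;> omega

lemma add_emod_two (a c : ℤ) : (a + c) % 2 = a % 2 + sgn a * (c % 2) := by
  rcases sgn_eq a with ⟨_, h⟩ | ⟨_, h⟩ <;> rw [h] <;> omega

lemma sgn_add (a c : ℤ) : sgn (a + c) = sgn a * sgn c := by
  rcases sgn_eq a with ⟨_, h1⟩ | ⟨_, h1⟩ <;> rcases sgn_eq c with ⟨_, h2⟩ | ⟨_, h2⟩ <;>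
    rw [h1, h2] <;> first | exact sgn_of_even (by omega) | exact sgn_of_odd (by omega)

lemma sgn_neg (a : ℤ) : sgn (-a) = sgn a := by
  unfold sgn; omega

lemma sgn_sgn_mul (b c : ℤ) : sgn (sgn b * c) = sgn c := by
  rcases sgn_eq b with ⟨-, h⟩ | ⟨-, h⟩ <;> simp [h, sgn_neg]

lemma sgn_add_sgn_mul (a b c : ℤ) : sgn (a + sgn b * c) = sgn a * sgn c := by
  rw [sgn_add, sgn_sgn_mul]

lemma sgn_neg_sgn_mul (a b : ℤ) : sgn (-(sgn a * b)) = sgn b := by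
  rw [sgn_neg, sgn_sgn_mul]

/-- Integer points with even coordinate sum; with the twisted multiplication below this is a
model of the Hantzsche–Wendt group. The point `(a, b, c)` stands for the isometry
`(u, v, w) ↦ (a + (-1) ^ c * u, b + (-1) ^ a * v, c + (-1) ^ b * w)`. -/
@[ext]
structure Model where
  a : ℤ
  b : ℤ
  c : ℤ
  even : (a + b + c) % 2 = 0

namespace Model

instance : Mul Model where
  mul s t := ⟨s.a + sgn s.c * t.a, s.b + sgn s.a * t.b, s.c + sgn s.b * t.c, by
    have := s.even
    have := t.even
    have := add_sgn_mul_emod_two s.a s.c t.a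
    have := add_sgn_mul_emod_two s.b s.a t.b
    have := add_sgn_mul_emod_two s.c s.b t.c
    omega⟩

instance : One Model where
  one := ⟨0, 0, 0, rfl⟩

instance : Inv Model where
  inv t := ⟨-(sgn t.c * t.a), -(sgn t.a * t.b), -(sgn t.b * t.c), by
    have := t.even
    have := add_sgn_mul_emod_two 0 t.c t.a
    have := add_sgn_mul_emod_two 0 t.a t.b
    have := add_sgn_mul_emod_two 0 t.b t.c
    omega⟩

@[simp] lemma mul_a (s t : Model) : (s * t).a = s.a + sgn s.c * t.a := rfl
@[simp] lemma mul_b (s t : Model) : (s * t).b = s.b + sgn s.a * t.b := rfl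
@[simp] lemma mul_c (s t : Model) : (s * t).c = s.c + sgn s.b * t.c := rfl
@[simp] lemma one_a : (1 : Model).a = 0 := rfl
@[simp] lemma one_b : (1 : Model).b = 0 := rfl
@[simp] lemma one_c : (1 : Model).c = 0 := rfl
@[simp] lemma inv_a (t : Model) : t⁻¹.a = -(sgn t.c * t.a) := rfl
@[simp] lemma inv_b (t : Model) : t⁻¹.b = -(sgn t.a * t.b) := rfl
@[simp] lemma inv_c (t : Model) : t⁻¹.c = -(sgn t.b * t.c) := rfl

instance : Group Model :=
  Group.ofLeftAxioms
    (fun r s t => by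
      ext <;> simp only [mul_a, mul_b, mul_c, sgn_add_sgn_mul] <;> ring)
    (fun t => by ext <;> simp)
    (fun t => by
      ext <;> simp only [mul_a, mul_b, mul_c, inv_a, inv_b, inv_c, sgn_neg_sgn_mul, one_a, one_b,
        one_c] <;> ring)

/-- The translation by `(2 * u, 2 * v, 2 * w)`. -/
def transl (u v w : ℤ) : Model := ⟨2 * u, 2 * v, 2 * w, by omega⟩

@[simp] lemma transl_a (u v w : ℤ) : (transl u v w).a = 2 * u := rfl
@[simp] lemma transl_b (u v w : ℤ) : (transl u v w).b = 2 * v := rfl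
@[simp] lemma transl_c (u v w : ℤ) : (transl u v w).c = 2 * w := rfl

lemma transl_zero : transl 0 0 0 = 1 := rfl

lemma transl_mul (u v w u' v' w' : ℤ) :
    transl u v w * transl u' v' w' = transl (u + u') (v + v') (w + w') := by
  ext <;> simp [sgn_two_mul] <;> ring

lemma transl_inv (u v w : ℤ) : (transl u v w)⁻¹ = transl (-u) (-v) (-w) := by
  ext <;> simp [sgn_two_mul]

lemma exists_eq_transl {t : Model} (ha : t.a % 2 = 0) (hb : t.b % 2 = 0) :
    ∃ u v w, t = transl u v w := by
  have := t.even
  refine ⟨t.a / 2, t.b / 2, t.c / 2, ?_⟩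
  ext <;> simp <;> omega

/-- Half-turn screw motion along the first axis. -/
def IsTypeX (t : Model) : Prop := t.a % 2 = 1 ∧ t.b % 2 = 1

/-- Half-turn screw motion along the second axis. -/
def IsTypeY (t : Model) : Prop := t.a % 2 = 0 ∧ t.b % 2 = 1

lemma exists_mul_transl {h k : Model} (hh : IsTypeX h) (hk : IsTypeY k) (t : Model) :
    ∃ r ∈ ({1, h, k, h * k} : Set Model), ∃ u v w, t = r * transl u v w := by
  obtain ⟨h1, h2⟩ := hh
  obtain ⟨k1, k2⟩ := hk
  suffices H : ∃ r ∈ ({1, h, k, h * k} : Set Model), r.a % 2 = t.a % 2 ∧ r.b % 2 = t.b % 2 by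
    obtain ⟨r, hr, ha, hb⟩ := H
    have e1 := add_sgn_mul_emod_two 0 r.c r.a
    have e2 := add_sgn_mul_emod_two 0 r.a r.b
    obtain ⟨u, v, w, h⟩ := exists_eq_transl (t := r⁻¹ * t)
      (by rw [mul_a, inv_a, add_sgn_mul_emod_two]; omega)
      (by rw [mul_b, inv_b, add_sgn_mul_emod_two]; omega)
    exact ⟨r, hr, u, v, w, by rw [← h, mul_inv_cancel_left]⟩
  rcases Int.emod_two_eq_zero_or_one t.a with ha | ha <;>
    rcases Int.emod_two_eq_zero_or_one t.b with hb | hb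
  · exact ⟨1, by simp, by simp [ha, hb]⟩
  · exact ⟨k, by simp, by omega⟩
  · refine ⟨h * k, by simp, ?_⟩
    rw [mul_a, mul_b, add_sgn_mul_emod_two, add_sgn_mul_emod_two]
    omega
  · exact ⟨h, by simp, by omega⟩

lemma eq_of_translations {H K : Subgroup Model} {h k : Model} (hh : IsTypeX h) (hk : IsTypeY k)
    (hH : h ∈ H) (kH : k ∈ H) (hK : h ∈ K) (kK : k ∈ K)
    (heq : ∀ u v w, transl u v w ∈ H ↔ transl u v w ∈ K) : H = K := by
  ext t
  obtain ⟨r, hr, u, v, w, rfl⟩ := exists_mul_transl hh hk t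
  have : r ∈ H ∧ r ∈ K := by
    rcases hr with rfl | rfl | rfl | rfl
    · exact ⟨H.one_mem, K.one_mem⟩
    · exact ⟨hH, hK⟩
    · exact ⟨kH, kK⟩
    · exact ⟨H.mul_mem hH kH, K.mul_mem hK kK⟩
  rw [H.mul_mem_cancel_left this.1, K.mul_mem_cancel_left this.2, heq]

/-- An embedded copy of the Hantzsche–Wendt group has full holonomy. -/
lemma parity_of_relations {h k : Model} (h1 : h ≠ 1) (k1 : k ≠ 1)
    (r1 : k * k * h * (k * k) = h) (r2 : h * h * k * (h * h) = k) :
    ¬ (h.a % 2 = 0 ∧ h.b % 2 = 0) ∧ ¬ (k.a % 2 = 0 ∧ k.b % 2 = 0) ∧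
      ¬ (h.a % 2 = k.a % 2 ∧ h.b % 2 = k.b % 2) := by
  obtain ⟨p, q, r, e⟩ := h
  obtain ⟨p', q', r', e'⟩ := k
  simp only [ne_eq, Model.ext_iff, mul_a, mul_b, mul_c, one_a, one_b, one_c, sgn_add, sgn_sgn_mul,
    sgn_mul_self, one_mul] at *
  rcases sgn_eq p with ⟨hp, hp'⟩ | ⟨hp, hp'⟩ <;> rcases sgn_eq q with ⟨hq, hq'⟩ | ⟨hq, hq'⟩ <;>
  rcases sgn_eq r with ⟨hr, hr'⟩ | ⟨hr, hr'⟩ <;>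
  first
  | omega
  | rcases sgn_eq p' with ⟨jp, jp'⟩ | ⟨jp, jp'⟩ <;> rcases sgn_eq q' with ⟨jq, jq'⟩ | ⟨jq, jq'⟩ <;>
    rcases sgn_eq r' with ⟨jr, jr'⟩ | ⟨jr, jr'⟩ <;>
    first
    | omega
    | simp only [hp', hq', hr', jp', jq', jr'] at r1 r2
      omega

lemma exists_types {H : Subgroup Model} {h k : Model} (hH : h ∈ H) (kH : k ∈ H)
    (h1 : h ≠ 1) (k1 : k ≠ 1)
    (r1 : k * k * h * (k * k) = h) (r2 : h * h * k * (h * h) = k) :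
    (∃ x ∈ H, IsTypeX x) ∧ ∃ y ∈ H, IsTypeY y := by
  obtain ⟨n1, n2, n3⟩ := parity_of_relations h1 k1 r1 r2
  have lH := H.mul_mem hH kH
  have la : (h * k).a % 2 = (h.a + k.a) % 2 := by rw [mul_a, add_sgn_mul_emod_two]
  have lb : (h * k).b % 2 = (h.b + k.b) % 2 := by rw [mul_b, add_sgn_mul_emod_two]
  have key : ∀ p q : ℤ, p % 2 = p → q % 2 = q → ¬ (p = 0 ∧ q = 0) →
      ∃ x ∈ H, x.a % 2 = p ∧ x.b % 2 = q := by
    intro p q hp hq hpq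
    by_cases c1 : h.a % 2 = p ∧ h.b % 2 = q
    · exact ⟨h, hH, c1⟩
    by_cases c2 : k.a % 2 = p ∧ k.b % 2 = q
    · exact ⟨k, kH, c2⟩
    exact ⟨h * k, lH, by omega⟩
  exact ⟨key 1 1 rfl rfl (by simp), key 0 1 rfl rfl (by simp)⟩

end Model

lemma exists_odd_generator {P : ℤ → Prop} (h0 : P 0) (hadd : ∀ u v, P u → P v → P (u + v))
    (hneg : ∀ u, P u → P (-u)) {p : ℤ} (hp : p % 2 = 1) (hP : P p) :
    ∃ α : ℕ, Odd α ∧ ∀ u, P u ↔ (α : ℤ) ∣ u := by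
  let S : AddSubgroup ℤ :=
    { carrier := {u | P u}
      zero_mem' := h0
      add_mem' := fun {u v} => hadd u v
      neg_mem' := fun {u} => hneg u }
  obtain ⟨g, hg⟩ := Int.subgroup_cyclic S
  have key : ∀ u, P u ↔ ((g.natAbs : ℕ) : ℤ) ∣ u := fun u => by
    have : u ∈ S ↔ g ∣ u := by
      rw [hg, ← AddSubgroup.zmultiples_eq_closure, Int.mem_zmultiples_iff]
    rw [Int.natAbs_dvd, ← this]
    rfl
  refine ⟨g.natAbs, ?_, key⟩
  obtain ⟨m, hm⟩ := (key p).1 hP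
  have : Odd p := Int.odd_iff.2 hp
  rw [hm, Int.odd_mul] at this
  exact_mod_cast this.1

lemma dvd_two_mul_iff {α : ℕ} (hα : Odd α) (u : ℤ) : (α : ℤ) ∣ 2 * u ↔ (α : ℤ) ∣ u := by
  refine ⟨fun h => IsCoprime.dvd_of_dvd_mul_left ?_ h, fun h => h.mul_left 2⟩
  exact_mod_cast Nat.isCoprime_iff_coprime.2 hα.coprime_two_right

lemma sgn_mul_emod_two (b c : ℤ) : sgn b * c % 2 = c % 2 := by
  simpa using add_sgn_mul_emod_two 0 b c

lemma crossed_mul (a c a' c' b s : ℤ) :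
    a + sgn c * a' - (c + sgn b * c') % 2 * s =
      a - c % 2 * s + sgn c * (a' - c' % 2 * s) := by
  rw [add_sgn_mul_emod_two, add_emod_two]
  ring

lemma crossed_inv (a c b s : ℤ) :
    -(sgn c * a) - -(sgn b * c) % 2 * s = -sgn c * (a - c % 2 * s) := by
  rw [Int.neg_emod_two, sgn_mul_emod_two]
  rcases sgn_eq c with ⟨e, h⟩ | ⟨e, h⟩ <;> rw [e, h] <;> ring

lemma dvd_add_sgn_mul_cancel (m x y c : ℤ) (h : m ∣ x) : m ∣ x + sgn c * y ↔ m ∣ y := by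
  rw [dvd_add_right h]
  rcases sgn_eq c with ⟨e, h⟩ | ⟨e, h⟩ <;> simp [h]

namespace Model

/-- The subgroup with translation lattice `2αℤ × 2βℤ × 2γℤ` and offsets `p, q, r`. -/
def sub (α β γ : ℕ) (p q r : ℤ) : Subgroup Model where
  carrier := {t | (α : ℤ) ∣ t.a - t.c % 2 * p ∧ (β : ℤ) ∣ t.b - t.a % 2 * q ∧
    (γ : ℤ) ∣ t.c - t.b % 2 * r}
  one_mem' := by simp
  mul_mem' := by
    rintro s t ⟨h1, h2, h3⟩ ⟨h1', h2', h3'⟩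
    simp only [Set.mem_ofPred_eq, mul_a, mul_b, mul_c, crossed_mul]
    exact ⟨h1.add (h1'.mul_left _), h2.add (h2'.mul_left _), h3.add (h3'.mul_left _)⟩
  inv_mem' := by
    rintro t ⟨h1, h2, h3⟩
    simp only [Set.mem_ofPred_eq, inv_a, inv_b, inv_c, crossed_inv]
    exact ⟨h1.mul_left _, h2.mul_left _, h3.mul_left _⟩

lemma mem_sub {α β γ : ℕ} {p q r : ℤ} {t : Model} :
    t ∈ sub α β γ p q r ↔ (α : ℤ) ∣ t.a - t.c % 2 * p ∧ (β : ℤ) ∣ t.b - t.a % 2 * q ∧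
      (γ : ℤ) ∣ t.c - t.b % 2 * r := Iff.rfl

lemma transl_mem_sub {α β γ : ℕ} (hα : Odd α) (hβ : Odd β) (hγ : Odd γ) {p q r u v w : ℤ} :
    transl u v w ∈ sub α β γ p q r ↔ (α : ℤ) ∣ u ∧ (β : ℤ) ∣ v ∧ (γ : ℤ) ∣ w := by
  simp [mem_sub, dvd_two_mul_iff, hα, hβ, hγ]

/-- The coset invariant of `sub α β γ p q r`. -/
def coord (α β γ : ℕ) (p q r : ℤ) (t : Model) : ZMod α × ZMod β × ZMod γ :=
  ((t.a - t.c % 2 * p : ℤ), (t.b - t.a % 2 * q : ℤ), (t.c - t.b % 2 * r : ℤ))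

lemma coord_eq_iff {α β γ : ℕ} {p q r : ℤ} {s t : Model} :
    coord α β γ p q r s = coord α β γ p q r t ↔ s⁻¹ * t ∈ sub α β γ p q r := by
  have key : ∀ (m : ℕ) (x y c : ℤ), ((x : ZMod m) = (x + sgn c * y : ℤ)) ↔ (m : ℤ) ∣ y := by
    intro m x y c
    rw [ZMod.intCast_eq_intCast_iff_dvd_sub, add_sub_cancel_left]
    simpa using dvd_add_sgn_mul_cancel m 0 y c (dvd_zero _)
  obtain ⟨t, rfl⟩ : ∃ t', t = s * t' := ⟨s⁻¹ * t, by simp⟩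
  simp only [inv_mul_cancel_left, coord, mul_a, mul_b, mul_c, crossed_mul, Prod.mk.injEq, key,
    mem_sub]

lemma exists_intCast_two_mul {α : ℕ} (hα : Odd α) (x : ZMod α) :
    ∃ u : ℤ, ((2 * u : ℤ) : ZMod α) = x := by
  obtain ⟨k, rfl⟩ := hα
  obtain ⟨y, rfl⟩ := ZMod.intCast_surjective x
  refine ⟨(k + 1) * y, ?_⟩
  rw [eq_comm, ZMod.intCast_eq_intCast_iff_dvd_sub]
  exact ⟨y, by push_cast; ring⟩

lemma coord_surjective {α β γ : ℕ} (hα : Odd α) (hβ : Odd β) (hγ : Odd γ) (p q r : ℤ) :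
    Function.Surjective (coord α β γ p q r) := by
  rintro ⟨x, y, z⟩
  obtain ⟨u, rfl⟩ := exists_intCast_two_mul hα x
  obtain ⟨v, rfl⟩ := exists_intCast_two_mul hβ y
  obtain ⟨w, rfl⟩ := exists_intCast_two_mul hγ z
  exact ⟨transl u v w, by simp [coord]⟩

lemma index_sub {α β γ : ℕ} (hα : Odd α) (hβ : Odd β) (hγ : Odd γ) (p q r : ℤ) :
    (sub α β γ p q r).index = α * β * γ := by
  let f : Model ⧸ sub α β γ p q r → ZMod α × ZMod β × ZMod γ :=
    Quotient.lift (coord α β γ p q r)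
      fun s t h => coord_eq_iff.2 (QuotientGroup.leftRel_apply.1 h)
  have hf : Function.Bijective f := by
    constructor
    · intro s t
      induction s using QuotientGroup.induction_on
      induction t using QuotientGroup.induction_on
      exact fun h => QuotientGroup.eq.2 (coord_eq_iff.1 h)
    · intro x
      obtain ⟨t, rfl⟩ := coord_surjective hα hβ hγ p q r x
      exact ⟨(t : Model ⧸ sub α β γ p q r), rfl⟩
  rw [Subgroup.index, Nat.card_congr (Equiv.ofBijective f hf)]
  simp [mul_assoc]

lemma scale_emod_two {α : ℕ} (hα : Odd α) (a e p : ℤ) :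
    (α * a + e * ((α + 1) * p)) % 2 = a % 2 := by
  obtain ⟨m, rfl⟩ := hα
  have : ((2 * m + 1 : ℕ) : ℤ) * a + e * (((2 * m + 1 : ℕ) + 1) * p) =
      a + 2 * (m * a + e * ((m + 1) * p)) := by push_cast; ring
  rw [this, Int.add_mul_emod_self_left]

lemma sgn_congr {a b : ℤ} (h : a % 2 = b % 2) : sgn a = sgn b := by
  rw [sgn, sgn, h]

/-- The affine self-embedding with image `sub α β γ p q r`. -/
def scale {α β γ : ℕ} (hα : Odd α) (hβ : Odd β) (hγ : Odd γ) (p q r : ℤ) : Model →* Model :=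
  MonoidHom.mk' (fun t =>
    ⟨α * t.a + t.c % 2 * ((α + 1) * p), β * t.b + t.a % 2 * ((β + 1) * q),
      γ * t.c + t.b % 2 * ((γ + 1) * r), by
        have := t.even
        have := scale_emod_two hα t.a (t.c % 2) p
        have := scale_emod_two hβ t.b (t.a % 2) q
        have := scale_emod_two hγ t.c (t.b % 2) r
        omega⟩) (by
    intro s t
    ext <;> simp only [mul_a, mul_b, mul_c, sgn_congr (scale_emod_two hα _ _ _),
      sgn_congr (scale_emod_two hβ _ _ _), sgn_congr (scale_emod_two hγ _ _ _),
      add_emod_two, sgn_mul_emod_two] <;> ring)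

section
variable {α β γ : ℕ} (hα : Odd α) (hβ : Odd β) (hγ : Odd γ) (p q r : ℤ)

lemma scale_a (t : Model) :
    (scale hα hβ hγ p q r t).a = α * t.a + t.c % 2 * ((α + 1) * p) := rfl

lemma scale_b (t : Model) :
    (scale hα hβ hγ p q r t).b = β * t.b + t.a % 2 * ((β + 1) * q) := rfl

lemma scale_c (t : Model) :
    (scale hα hβ hγ p q r t).c = γ * t.c + t.b % 2 * ((γ + 1) * r) := rfl

lemma scale_injective : Function.Injective (scale hα hβ hγ p q r) := by
  rw [injective_iff_map_eq_one]
  intro t ht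
  have ha := congrArg Model.a ht
  have hb := congrArg Model.b ht
  have hc := congrArg Model.c ht
  have ea := scale_emod_two hα t.a (t.c % 2) p
  have eb := scale_emod_two hβ t.b (t.a % 2) q
  have ec := scale_emod_two hγ t.c (t.b % 2) r
  simp only [scale_a, scale_b, scale_c, one_a, one_b, one_c] at ha hb hc
  rw [ha] at ea
  rw [hb] at eb
  rw [hc] at ec
  simp only [← ea, ← eb, ← ec, EuclideanDomain.zero_mod, zero_mul, add_zero, mul_eq_zero,
    Nat.cast_eq_zero, hα.pos.ne', hβ.pos.ne', hγ.pos.ne', false_or] at ha hb hc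
  ext <;> assumption

lemma exists_scale_preimage {α : ℕ} {a e p : ℤ} (h : (α : ℤ) ∣ a - e * p) :
    ∃ a', a = α * a' + e * ((α + 1) * p) := by
  obtain ⟨u, hu⟩ := h
  exact ⟨u - e * p, by linear_combination hu⟩

lemma range_scale : (scale hα hβ hγ p q r).range = sub α β γ p q r := by
  ext t
  constructor
  · rintro ⟨t, rfl⟩
    simp only [mem_sub, scale_a, scale_b, scale_c, scale_emod_two hα, scale_emod_two hβ,
      scale_emod_two hγ]
    exact ⟨⟨t.a + t.c % 2 * p, by ring⟩, ⟨t.b + t.a % 2 * q, by ring⟩,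
      ⟨t.c + t.b % 2 * r, by ring⟩⟩
  · rintro ⟨h1, h2, h3⟩
    obtain ⟨a, ha⟩ := exists_scale_preimage h1
    obtain ⟨b, hb⟩ := exists_scale_preimage h2
    obtain ⟨c, hc⟩ := exists_scale_preimage h3
    have ea := scale_emod_two hα a (t.c % 2) p
    have eb := scale_emod_two hβ b (t.a % 2) q
    have ec := scale_emod_two hγ c (t.b % 2) r
    rw [← ha] at ea
    rw [← hb] at eb
    rw [← hc] at ec
    refine ⟨⟨a, b, c, by have := t.even; omega⟩, ?_⟩
    ext
    · change α * a + c % 2 * _ = _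
      rw [← ec, ← ha]
    · change β * b + a % 2 * _ = _
      rw [← ea, ← hb]
    · change γ * c + b % 2 * _ = _
      rw [← eb, ← hc]

end

lemma nonempty_sub_mulEquiv {α β γ : ℕ} (hα : Odd α) (hβ : Odd β) (hγ : Odd γ) (p q r : ℤ) :
    Nonempty (sub α β γ p q r ≃* Model) := by
  rw [← range_scale hα hβ hγ]
  exact ⟨(MonoidHom.ofInjective (scale_injective hα hβ hγ p q r)).symm⟩

lemma eq_of_dvd_offset {α : ℕ} {s s' m : ℕ} (hs : s < α) (hs' : s' < α)
    (h : (α : ℤ) ∣ (α * m + (α + 1) * s : ℤ) - s') : s = s' := by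
  have h2 : (α : ℤ) ∣ (s : ℤ) - s' := by
    have := h.sub (Dvd.intro (m + s : ℤ) rfl)
    ring_nf at this ⊢
    exact this
  have := Int.eq_zero_of_abs_lt_dvd h2 (by rw [abs_lt]; omega)
  omega

lemma sub_injective {α β γ α' β' γ' : ℕ} (hα : Odd α) (hβ : Odd β) (hγ : Odd γ)
    (hα' : Odd α') (hβ' : Odd β') (hγ' : Odd γ') {p q r p' q' r' : ℕ}
    (hp : p < α) (hq : q < β) (hr : r < γ) (hp' : p' < α') (hq' : q' < β') (hr' : r' < γ')
    (h : sub α β γ p q r = sub α' β' γ' p' q' r') :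
    (α = α' ∧ β = β' ∧ γ = γ') ∧ p = p' ∧ q = q' ∧ r = r' := by
  have key : ∀ u v w : ℤ, ((α : ℤ) ∣ u ∧ (β : ℤ) ∣ v ∧ (γ : ℤ) ∣ w) ↔
      ((α' : ℤ) ∣ u ∧ (β' : ℤ) ∣ v ∧ (γ' : ℤ) ∣ w) := fun u v w => by
    rw [← transl_mem_sub hα hβ hγ, h, transl_mem_sub hα' hβ' hγ']
  have h1 := (key α β γ).1 ⟨dvd_rfl, dvd_rfl, dvd_rfl⟩
  have h2 := (key α' β' γ').2 ⟨dvd_rfl, dvd_rfl, dvd_rfl⟩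
  simp only [Int.natCast_dvd_natCast] at h1 h2
  obtain rfl := Nat.dvd_antisymm h2.1 h1.1
  obtain rfl := Nat.dvd_antisymm h2.2.1 h1.2.1
  obtain rfl := Nat.dvd_antisymm h2.2.2 h1.2.2
  have hx : scale hα hβ hγ p q r ⟨1, 1, 0, rfl⟩ ∈ sub α β γ p' q' r' := by
    rw [← h, ← range_scale hα hβ hγ]
    exact ⟨_, rfl⟩
  have hy : scale hα hβ hγ p q r ⟨0, 1, 1, rfl⟩ ∈ sub α β γ p' q' r' := by
    rw [← h, ← range_scale hα hβ hγ]
    exact ⟨_, rfl⟩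
  simp only [mem_sub, scale_a, scale_b, scale_c, scale_emod_two hα, scale_emod_two hβ,
    scale_emod_two hγ] at hx hy
  refine ⟨⟨rfl, rfl, rfl⟩, eq_of_dvd_offset (m := 0) hp hp' ?_, eq_of_dvd_offset (m := 1) hq hq' ?_,
    eq_of_dvd_offset (m := 0) hr hr' ?_⟩
  · simpa using hy.1
  · simpa using hx.2.1
  · simpa using hx.2.2

lemma sq_of_isTypeX {t : Model} (h : IsTypeX t) : t * t = transl t.a 0 0 := by
  have e := t.even
  obtain ⟨h1, h2⟩ := h
  ext <;> simp [sgn_of_odd h1, sgn_of_odd h2, sgn_of_even (show t.c % 2 = 0 by omega)]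
  ring

lemma sq_of_isTypeY {t : Model} (h : IsTypeY t) : t * t = transl 0 t.b 0 := by
  have e := t.even
  obtain ⟨h1, h2⟩ := h
  ext <;> simp [sgn_of_even h1, sgn_of_odd h2, sgn_of_odd (show t.c % 2 = 1 by omega)]
  ring

lemma sq_of_isTypeX_mul_isTypeY {h k : Model} (hh : IsTypeX h) (hk : IsTypeY k) :
    h * k * (h * k) = transl 0 0 (h.c - k.c) := by
  have e := h.even
  have e' := k.even
  obtain ⟨h1, h2⟩ := hh
  obtain ⟨k1, k2⟩ := hk
  ext <;> simp [sgn_add, sgn_neg, sgn_of_odd h1, sgn_of_odd h2,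
    sgn_of_even (show h.c % 2 = 0 by omega), sgn_of_even k1, sgn_of_odd k2,
    sgn_of_odd (show k.c % 2 = 1 by omega)]
  ring

lemma isTypeX_conj {h : Model} (hh : IsTypeX h) (u v w : ℤ) :
    transl u v w * (h * transl u v w * h⁻¹) = transl (2 * u) 0 0 := by
  have e := h.even
  obtain ⟨h1, h2⟩ := hh
  ext <;> simp [sgn_add, sgn_neg, sgn_two_mul, sgn_of_odd h1, sgn_of_odd h2,
    sgn_of_even (show h.c % 2 = 0 by omega)]
  ring

lemma isTypeY_conj {h : Model} (hh : IsTypeY h) (u v w : ℤ) :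
    transl u v w * (h * transl u v w * h⁻¹) = transl 0 (2 * v) 0 := by
  have e := h.even
  obtain ⟨h1, h2⟩ := hh
  ext <;> simp [sgn_add, sgn_neg, sgn_two_mul, sgn_of_even h1, sgn_of_odd h2,
    sgn_of_odd (show h.c % 2 = 1 by omega)]
  ring

lemma exists_nat_offset {α : ℕ} (hα : Odd α) (a : ℤ) : ∃ p < α, (α : ℤ) ∣ a - p := by
  have h : (α : ℤ) ≠ 0 := by exact_mod_cast hα.pos.ne'
  have h1 := Int.emod_nonneg a h
  have h2 := Int.emod_lt_of_pos a (show (0 : ℤ) < α by exact_mod_cast hα.pos)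
  refine ⟨(a % α).toNat, by omega, ?_⟩
  rw [Int.toNat_of_nonneg h1]
  exact Int.dvd_self_sub_emod

theorem exists_eq_sub {H : Subgroup Model} {h k : Model} (hh : IsTypeX h) (hk : IsTypeY k)
    (hH : h ∈ H) (kH : k ∈ H) :
    ∃ α β γ p q r : ℕ, (Odd α ∧ Odd β ∧ Odd γ) ∧ (p < α ∧ q < β ∧ r < γ) ∧
      H = sub α β γ p q r := by
  have he := h.even
  have ke := k.even
  have hsq := H.mul_mem hH hH
  have ksq := H.mul_mem kH kH
  have lsq := H.mul_mem (H.mul_mem hH kH) (H.mul_mem hH kH)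
  rw [sq_of_isTypeX hh] at hsq
  rw [sq_of_isTypeY hk] at ksq
  rw [sq_of_isTypeX_mul_isTypeY hh hk] at lsq
  obtain ⟨h1, h2⟩ := id hh
  obtain ⟨k1, k2⟩ := id hk
  obtain ⟨α, hα, Hα⟩ := exists_odd_generator (P := fun u => transl u 0 0 ∈ H) H.one_mem
    (fun u v hu hv => by simpa [transl_mul] using H.mul_mem hu hv)
    (fun u hu => by simpa [transl_inv] using H.inv_mem hu) h1 hsq
  obtain ⟨β, hβ, Hβ⟩ := exists_odd_generator (P := fun u => transl 0 u 0 ∈ H) H.one_mem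
    (fun u v hu hv => by simpa [transl_mul] using H.mul_mem hu hv)
    (fun u hu => by simpa [transl_inv] using H.inv_mem hu) k2 ksq
  obtain ⟨γ, hγ, Hγ⟩ := exists_odd_generator (P := fun u => transl 0 0 u ∈ H) H.one_mem
    (fun u v hu hv => by simpa [transl_mul] using H.mul_mem hu hv)
    (fun u hu => by simpa [transl_inv] using H.inv_mem hu) (by omega) lsq
  have lattice : ∀ u v w, transl u v w ∈ H ↔ (α : ℤ) ∣ u ∧ (β : ℤ) ∣ v ∧ (γ : ℤ) ∣ w := by
    intro u v w
    rw [← Hα, ← Hβ, ← Hγ]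
    constructor
    · intro ht
      have conj : ∀ g ∈ H, transl u v w * (g * transl u v w * g⁻¹) ∈ H := fun g hg =>
        H.mul_mem ht (H.mul_mem (H.mul_mem hg ht) (H.inv_mem hg))
      have hu : transl u 0 0 ∈ H := by
        have := conj h hH
        rwa [isTypeX_conj hh, Hα, dvd_two_mul_iff hα, ← Hα] at this
      have hv : transl 0 v 0 ∈ H := by
        have := conj k kH
        rwa [isTypeY_conj hk, Hβ, dvd_two_mul_iff hβ, ← Hβ] at this
      refine ⟨hu, hv, ?_⟩
      have := H.mul_mem (H.inv_mem (H.mul_mem hu hv)) ht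
      simpa [transl_mul, transl_inv] using this
    · rintro ⟨hu, hv, hw⟩
      simpa [transl_mul] using H.mul_mem (H.mul_mem hu hv) hw
  obtain ⟨p, hp, Hp⟩ := exists_nat_offset hα k.a
  obtain ⟨q, hq, Hq⟩ := exists_nat_offset hβ h.b
  obtain ⟨r, hr, Hr⟩ := exists_nat_offset hγ h.c
  rw [Hα] at hsq
  rw [Hβ] at ksq
  rw [Hγ] at lsq
  refine ⟨α, β, γ, p, q, r, ⟨hα, hβ, hγ⟩, ⟨hp, hq, hr⟩,
    eq_of_translations hh hk hH kH ?_ ?_ fun u v w => ?_⟩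
  · rw [mem_sub, h1, h2, show h.c % 2 = 0 by omega]
    simpa using ⟨hsq, Hq, Hr⟩
  · rw [mem_sub, k1, k2, show k.c % 2 = 1 by omega]
    have : (γ : ℤ) ∣ k.c - r := by simpa using Hr.sub lsq
    simpa using ⟨Hp, ksq, this⟩
  · rw [lattice, transl_mem_sub hα hβ hγ]

end Model

/-- Ordered triples of positive integers with product `n`, for `n > 0`. -/
def triples (n : ℕ) : Finset (ℕ × ℕ × ℕ) :=
  (Finset.range (n + 1) ×ˢ Finset.range (n + 1) ×ˢ Finset.range (n + 1)).filter
    (fun t => 0 < t.1 ∧ 0 < t.2.1 ∧ 0 < t.2.2 ∧ t.1 * t.2.1 * t.2.2 = n)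

lemma card_triples (n : ℕ) : (triples n).card = d3 n := rfl

lemma mem_triples {n : ℕ} (hn : 0 < n) {t : ℕ × ℕ × ℕ} :
    t ∈ triples n ↔ t.1 * t.2.1 * t.2.2 = n := by
  simp only [triples, Finset.mem_filter, Finset.mem_product, Finset.mem_range]
  refine ⟨fun h => h.2.2.2.2, fun h => ?_⟩
  have h1 : t.1 ∣ n := ⟨t.2.1 * t.2.2, by rw [← h, mul_assoc]⟩
  have h2 : t.2.1 ∣ n := ⟨t.1 * t.2.2, by rw [← h]; ring⟩
  have h3 : t.2.2 ∣ n := ⟨t.1 * t.2.1, by rw [← h]; ring⟩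
  exact ⟨⟨Nat.lt_succ_of_le (Nat.le_of_dvd hn h1), Nat.lt_succ_of_le (Nat.le_of_dvd hn h2),
    Nat.lt_succ_of_le (Nat.le_of_dvd hn h3)⟩, Nat.pos_of_dvd_of_pos h1 hn,
    Nat.pos_of_dvd_of_pos h2 hn, Nat.pos_of_dvd_of_pos h3 hn, h⟩

lemma card_triples_filter_dvd {n : ℕ} (hn : 0 < n) {i j k : ℕ} (hi : 0 < i) (hj : 0 < j)
    (hk : 0 < k) :
    ((triples n).filter fun t => i ∣ t.1 ∧ j ∣ t.2.1 ∧ k ∣ t.2.2).card = d3If n (i * j * k) := by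
  have hijk : 0 < i * j * k := by positivity
  rw [d3If]
  split_ifs with h
  · obtain ⟨m, rfl⟩ := h
    have hm : 0 < m := Nat.pos_of_mul_pos_left hn
    rw [Nat.mul_div_cancel_left _ hijk, ← card_triples]
    symm
    refine Finset.card_bij (fun t _ => (i * t.1, j * t.2.1, k * t.2.2)) ?_ ?_ ?_
    · intro t ht
      rw [mem_triples hm] at ht
      rw [Finset.mem_filter, mem_triples hn, ← ht]
      exact ⟨by ring, dvd_mul_right _ _, dvd_mul_right _ _, dvd_mul_right _ _⟩
    · rintro ⟨a, b, c⟩ - ⟨a', b', c'⟩ - h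
      simpa [hi.ne', hj.ne', hk.ne'] using h
    · rintro ⟨a, b, c⟩ h
      simp only [Finset.mem_filter, mem_triples hn] at h
      obtain ⟨h, ⟨a, rfl⟩, ⟨b, rfl⟩, ⟨c, rfl⟩⟩ := h
      refine ⟨(a, b, c), ?_, rfl⟩
      rw [mem_triples hm]
      exact Nat.eq_of_mul_eq_mul_left hijk (by rw [← h]; ring)
  · rw [Finset.card_eq_zero, Finset.filter_eq_empty_iff]
    intro t ht hd
    rw [mem_triples hn] at ht
    exact h (ht ▸ Nat.mul_dvd_mul (Nat.mul_dvd_mul hd.1 hd.2.1) hd.2.2)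

/-- Triples of odd positive integers with product `n`. -/
def oddTriples (n : ℕ) : Finset (ℕ × ℕ × ℕ) :=
  (triples n).filter fun t => Odd t.1 ∧ Odd t.2.1 ∧ Odd t.2.2

lemma card_oddTriples {n : ℕ} (hn : 0 < n) :
    (oddTriples n).card = if Odd n then d3 n else 0 := by
  have key : ∀ t ∈ triples n, (Odd t.1 ∧ Odd t.2.1 ∧ Odd t.2.2) ↔ Odd n := by
    intro t ht
    rw [← (mem_triples hn).1 ht, Nat.odd_mul, Nat.odd_mul, and_assoc]
  rw [oddTriples, Finset.filter_congr key]
  split_ifs with h <;> simp [h, card_triples]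

lemma card_oddTriples_eq_alternating {n : ℕ} (hn : 0 < n) :
    ((oddTriples n).card : ℤ) = d3 n - 3 * d3If n 2 + 3 * d3If n 4 - d3If n 8 := by
  have key : ∀ i j k : ℕ, 0 < i → 0 < j → 0 < k → (d3If n (i * j * k) : ℤ) =
      ∑ t ∈ triples n, if i ∣ t.1 ∧ j ∣ t.2.1 ∧ k ∣ t.2.2 then 1 else 0 := by
    intro i j k hi hj hk
    rw [← card_triples_filter_dvd hn hi hj hk, Finset.natCast_card_filter]
  have h000 : (d3 n : ℤ) = ∑ t ∈ triples n, 1 := by simp [card_triples]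
  have h100 := key 2 1 1 (by simp) (by simp) (by simp)
  have h010 := key 1 2 1 (by simp) (by simp) (by simp)
  have h001 := key 1 1 2 (by simp) (by simp) (by simp)
  have h110 := key 2 2 1 (by simp) (by simp) (by simp)
  have h101 := key 2 1 2 (by simp) (by simp) (by simp)
  have h011 := key 1 2 2 (by simp) (by simp) (by simp)
  have h111 := key 2 2 2 (by simp) (by simp) (by simp)
  norm_num only [one_dvd, true_and, and_true] at h100 h010 h001 h110 h101 h011 h111
  have h : ((oddTriples n).card : ℤ) = d3 n - (d3If n 2 + d3If n 2 + d3If n 2) +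
      (d3If n 4 + d3If n 4 + d3If n 4) - d3If n 8 := by
    nth_rw 1 [h100]
    nth_rw 1 [h010]
    nth_rw 1 [h001]
    nth_rw 1 [h110]
    nth_rw 1 [h101]
    nth_rw 1 [h011]
    rw [h111, h000, oddTriples, Finset.natCast_card_filter]
    simp only [← Finset.sum_add_distrib, ← Finset.sum_sub_distrib]
    refine Finset.sum_congr rfl fun t _ => ?_
    simp only [← Nat.not_even_iff_odd, even_iff_two_dvd]
    by_cases ha : 2 ∣ t.1 <;> by_cases hb : 2 ∣ t.2.1 <;> by_cases hc : 2 ∣ t.2.2 <;>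
      simp [ha, hb, hc]
  rw [h]
  ring

/-- Offsets for each triple of odd numbers with product `n`. -/
abbrev Param (n : ℕ) : Type := Σ t : oddTriples n, Fin t.1.1 × Fin t.1.2.1 × Fin t.1.2.2

lemma card_param {n : ℕ} (hn : 0 < n) : Nat.card (Param n) = n * (oddTriples n).card := by
  rw [Nat.card_eq_fintype_card, Fintype.card_sigma]
  have : ∀ t : oddTriples n, Fintype.card (Fin t.1.1 × Fin t.1.2.1 × Fin t.1.2.2) = n := by
    intro t
    have := (mem_triples hn).1 (Finset.mem_filter.1 t.2).1
    simpa [mul_assoc] using this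
  simp [this, mul_comm]

namespace Model

lemma exists_types_of_mulEquiv {H : Subgroup Model} (e : H ≃* Model) :
    (∃ x ∈ H, IsTypeX x) ∧ ∃ y ∈ H, IsTypeY y := by
  let x : Model := ⟨1, 1, 0, rfl⟩
  let y : Model := ⟨0, 1, 1, rfl⟩
  have r1 : y * y * x * (y * y) = x := by ext <;> rfl
  have r2 : x * x * y * (x * x) = y := by ext <;> rfl
  let f : Model →* Model := H.subtype.comp e.symm.toMonoidHom
  have hf : Function.Injective f := H.subtype_injective.comp e.symm.injective
  refine exists_types (h := f x) (k := f y) (e.symm x).2 (e.symm y).2 ?_ ?_ ?_ ?_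
  · rw [ne_eq, map_eq_one_iff f hf]
    exact fun h => one_ne_zero (congrArg Model.a h)
  · rw [ne_eq, map_eq_one_iff f hf]
    exact fun h => one_ne_zero (congrArg Model.b h)
  · simp only [← map_mul, r1]
  · simp only [← map_mul, r2]

theorem card_subgroups {n : ℕ} (hn : 0 < n) :
    Nat.card {H : Subgroup Model // H.index = n ∧ Nonempty (H ≃* Model)} =
      n * (oddTriples n).card := by
  rw [← card_param hn]
  symm
  have hodd : ∀ t : oddTriples n, Odd t.1.1 ∧ Odd t.1.2.1 ∧ Odd t.1.2.2 :=
    fun t => (Finset.mem_filter.1 t.2).2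
  have hprod : ∀ t : oddTriples n, t.1.1 * t.1.2.1 * t.1.2.2 = n :=
    fun t => (mem_triples hn).1 (Finset.mem_filter.1 t.2).1
  let f : Param n → {H : Subgroup Model // H.index = n ∧ Nonempty (H ≃* Model)} := fun P =>
    ⟨sub P.1.1.1 P.1.1.2.1 P.1.1.2.2 (P.2.1 : ℕ) (P.2.2.1 : ℕ) (P.2.2.2 : ℕ),
      (index_sub (hodd P.1).1 (hodd P.1).2.1 (hodd P.1).2.2 _ _ _).trans (hprod P.1),
      nonempty_sub_mulEquiv (hodd P.1).1 (hodd P.1).2.1 (hodd P.1).2.2 _ _ _⟩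
  refine Nat.card_congr (Equiv.ofBijective f ⟨?_, ?_⟩)
  · rintro ⟨⟨⟨α, β, γ⟩, ht⟩, p, q, r⟩ ⟨⟨⟨α', β', γ'⟩, ht'⟩, p', q', r'⟩ h
    have ho := hodd ⟨_, ht⟩
    have ho' := hodd ⟨_, ht'⟩
    obtain ⟨⟨rfl, rfl, rfl⟩, hp, hq, hr⟩ := sub_injective ho.1 ho.2.1 ho.2.2 ho'.1 ho'.2.1 ho'.2.2
      p.2 q.2 r.2 p'.2 q'.2 r'.2 (Subtype.ext_iff.1 h)
    rw [Fin.ext hp, Fin.ext hq, Fin.ext hr]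
  · rintro ⟨H, hH, ⟨e⟩⟩
    obtain ⟨⟨x, xH, hx⟩, y, yH, hy⟩ := exists_types_of_mulEquiv e
    obtain ⟨α, β, γ, p, q, r, ⟨hα, hβ, hγ⟩, ⟨hp, hq, hr⟩, rfl⟩ := exists_eq_sub hx hy xH yH
    rw [index_sub hα hβ hγ] at hH
    exact ⟨⟨⟨(α, β, γ), Finset.mem_filter.2 ⟨(mem_triples hn).2 hH, hα, hβ, hγ⟩⟩,
      ⟨p, hp⟩, ⟨q, hq⟩, ⟨r, hr⟩⟩, rfl⟩

lemma transl_zpow (u v w i : ℤ) : transl u v w ^ i = transl (i * u) (i * v) (i * w) := by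
  induction i with
  | zero => simp [transl_zero]
  | succ n ih => rw [zpow_add_one, ih, transl_mul]; congr 1 <;> ring
  | pred n ih => rw [zpow_sub_one, ih, transl_inv, transl_mul]; congr 1 <;> ring

end Model

section NormalForm

variable {G : Type*} [Group G] {x y : G}

/-- The group words `x ^ 2i * y ^ 2j * (x * y) ^ 2k`. -/
def word (x y : G) (i j k : ℤ) : G := (x * x) ^ i * (y * y) ^ j * (x * y * (x * y)) ^ k

lemma right_mul_left (h2 : SemiconjBy y (x * x) (x * x)⁻¹) :
    y * x = word x y (-1) 1 (-1) * (x * y) := by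
  simp only [word, zpow_neg, zpow_one]
  calc y * x = y * (x * x) * x⁻¹ := by group
    _ = (x * x)⁻¹ * y * x⁻¹ := by rw [h2.eq]
    _ = _ := by group

section
variable (h1 : SemiconjBy x (y * y) (y * y)⁻¹) (h2 : SemiconjBy y (x * x) (x * x)⁻¹)
include h1

lemma commute_sq_sq : Commute (x * x) (y * y) := by
  have := h1.inv_right.mul_left h1
  rwa [inv_inv] at this

include h2

lemma semiconjBy_mul_sq : SemiconjBy x (x * y * (x * y)) (x * y * (x * y))⁻¹ := by
  have e1 : y * (x * x) = x⁻¹ * x⁻¹ * y := by simpa [SemiconjBy, mul_assoc] using h2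
  have e2 : y * y * x = x * (y * y)⁻¹ := by
    simpa only [inv_inv] using h1.inv_right.eq.symm
  rw [SemiconjBy, eq_inv_mul_iff_mul_eq]
  calc x * y * (x * y) * (x * (x * y * (x * y)))
      = x * y * x * (y * (x * x)) * y * x * y := by group
    _ = x * y * x⁻¹ * (y * y * x) * y := by rw [e1]; group
    _ = x := by rw [e2]; group

lemma semiconjBy_mul_sq' : SemiconjBy y (x * y * (x * y)) (x * y * (x * y))⁻¹ := by
  have hx := (semiconjBy_mul_sq h1 h2).inv_right.inv_symm_left
  rw [inv_inv] at hx
  have hc : SemiconjBy (x * y) (x * y * (x * y)) (x * y * (x * y)) :=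
    (Commute.refl (x * y)).mul_right (Commute.refl (x * y))
  simpa only [inv_mul_cancel_left] using hx.mul_left hc

lemma commute_sq_mul_sq : Commute (x * x) (x * y * (x * y)) := by
  have h := semiconjBy_mul_sq h1 h2
  have := h.inv_right.mul_left h
  rwa [inv_inv] at this

lemma commute_sq_mul_sq' : Commute (y * y) (x * y * (x * y)) := by
  have h := semiconjBy_mul_sq' h1 h2
  have := h.inv_right.mul_left h
  rwa [inv_inv] at this

lemma word_mul_word (i j k i' j' k' : ℤ) :
    word x y i j k * word x y i' j' k' = word x y (i + i') (j + j') (k + k') := by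
  have c1 := (commute_sq_sq h1).zpow_zpow i' j
  have c2 := (commute_sq_mul_sq h1 h2).zpow_zpow i' k
  have c3 := (commute_sq_mul_sq' h1 h2).zpow_zpow j' k
  simp only [word, zpow_add]
  generalize (x * x) ^ i' = a, (y * y) ^ j = b, (y * y) ^ j' = b',
    (x * y * (x * y)) ^ k = c at c1 c2 c3 ⊢
  simp only [mul_assoc]
  rw [← c2.left_comm, ← c1.left_comm, ← c3.left_comm]

lemma mul_word_left (i j k : ℤ) : x * word x y i j k = word x y i (-j) (-k) * x := by
  have hX : SemiconjBy x (x * x) (x * x) := (Commute.refl x).mul_right (Commute.refl x)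
  have := ((hX.zpow_right i).mul_right (h1.zpow_right j)).mul_right
    ((semiconjBy_mul_sq h1 h2).zpow_right k)
  simpa only [word, inv_zpow'] using this.eq

lemma mul_word_right (i j k : ℤ) : y * word x y i j k = word x y (-i) j (-k) * y := by
  have hY : SemiconjBy y (y * y) (y * y) := (Commute.refl y).mul_right (Commute.refl y)
  have := ((h2.zpow_right i).mul_right (hY.zpow_right j)).mul_right
    ((semiconjBy_mul_sq' h1 h2).zpow_right k)
  simpa only [word, inv_zpow'] using this.eq

lemma right_mul_left_mul_right : y * (x * y) = word x y (-1) 0 (-1) * x := by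
  have e : y * y * x = x * (y * y)⁻¹ := by
    simpa only [inv_inv] using h1.inv_right.eq.symm
  have e' := h2.inv_right.eq
  rw [inv_inv] at e'
  simp only [word, zpow_neg, zpow_one, zpow_zero, mul_one]
  calc y * (x * y) = y⁻¹ * (y * y * x) * y := by group
    _ = y⁻¹ * (x * x) * y * (y⁻¹ * x⁻¹ * y⁻¹) := by rw [e]; group
    _ = y⁻¹ * (y * (x * x)⁻¹) * (y⁻¹ * x⁻¹ * y⁻¹) := by rw [e']; group
    _ = _ := by group

theorem exists_eq_word (htop : Subgroup.closure {x, y} = ⊤) (g : G) :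
    ∃ i j k, ∃ w ∈ ({1, x, y, x * y} : Set G), g = word x y i j k * w := by
  let S : Set G := {g | ∃ i j k, ∃ w ∈ ({1, x, y, x * y} : Set G), g = word x y i j k * w}
  have hN : ∀ i j k, ∀ g ∈ S, word x y i j k * g ∈ S := by
    rintro i j k _ ⟨i', j', k', w, hw, rfl⟩
    exact ⟨_, _, _, w, hw, by rw [← mul_assoc, word_mul_word h1 h2]⟩
  have hx : ∀ g ∈ S, x * g ∈ S := by
    rintro _ ⟨i, j, k, w, hw, rfl⟩
    rw [← mul_assoc, mul_word_left h1 h2, mul_assoc]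
    refine hN _ _ _ _ ?_
    rcases hw with h | h | h | h <;> rw [h]
    · exact ⟨0, 0, 0, x, by simp, by simp [word]⟩
    · exact ⟨1, 0, 0, 1, by simp, by simp [word]⟩
    · exact ⟨0, 0, 0, x * y, by simp, by simp [word]⟩
    · exact ⟨1, 0, 0, y, by simp, by simp [word, mul_assoc]⟩
  have hy : ∀ g ∈ S, y * g ∈ S := by
    rintro _ ⟨i, j, k, w, hw, rfl⟩
    rw [← mul_assoc, mul_word_right h1 h2, mul_assoc]
    refine hN _ _ _ _ ?_
    rcases hw with h | h | h | h <;> rw [h]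
    · exact ⟨0, 0, 0, y, by simp, by simp [word]⟩
    · exact ⟨-1, 1, -1, x * y, by simp, right_mul_left h2⟩
    · exact ⟨0, 1, 0, 1, by simp, by simp [word]⟩
    · exact ⟨-1, 0, -1, x, by simp, right_mul_left_mul_right h1 h2⟩
  have hg : g ∈ Subgroup.closure {x, y} := htop ▸ Subgroup.mem_top g
  induction hg using Subgroup.closure_induction_left with
  | one => exact ⟨0, 0, 0, 1, by simp, by simp [word]⟩
  | mul_left a ha g _ ih =>
    rcases ha with h | h <;> rw [h]
    · exact hx g ih
    · exact hy g ih
  | inv_mul_cancel a ha g _ ih =>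
    rcases ha with h | h <;> rw [h]
    · have e : x⁻¹ * g = word x y (-1) 0 0 * (x * g) := by simp [word, mul_assoc]
      rw [e]
      exact hN _ _ _ _ (hx g ih)
    · have e : y⁻¹ * g = word x y 0 (-1) 0 * (y * g) := by simp [word, mul_assoc]
      rw [e]
      exact hN _ _ _ _ (hy g ih)

end

end NormalForm

lemma hwx_semiconjBy : SemiconjBy hwx (hwy * hwy) (hwy * hwy)⁻¹ := by
  have h : hwx * hwy ^ 2 * hwx⁻¹ * hwy ^ 2 = 1 :=
    PresentedGroup.one_of_mem (rels := hwRels) (Or.inl rfl)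
  rw [SemiconjBy, ← pow_two, ← mul_inv_eq_iff_eq_mul]
  exact eq_inv_of_mul_eq_one_left h

lemma hwy_semiconjBy : SemiconjBy hwy (hwx * hwx) (hwx * hwx)⁻¹ := by
  have h : hwy * hwx ^ 2 * hwy⁻¹ * hwx ^ 2 = 1 :=
    PresentedGroup.one_of_mem (rels := hwRels) (Or.inr (Or.inl rfl))
  rw [SemiconjBy, ← pow_two, ← mul_inv_eq_iff_eq_mul]
  exact eq_inv_of_mul_eq_one_left h

lemma closure_hwx_hwy : Subgroup.closure {hwx, hwy} = ⊤ := by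
  have h : hwx * hwy * hwz = 1 :=
    PresentedGroup.one_of_mem (rels := hwRels) (Or.inr (Or.inr rfl))
  have hx : hwx ∈ Subgroup.closure {hwx, hwy} := Subgroup.subset_closure (by simp)
  have hy : hwy ∈ Subgroup.closure {hwx, hwy} := Subgroup.subset_closure (by simp)
  rw [eq_top_iff, ← PresentedGroup.closure_range_of hwRels, Subgroup.closure_le]
  rintro _ ⟨i, rfl⟩
  fin_cases i
  · exact hx
  · exact hy
  · change hwz ∈ _
    rw [eq_inv_of_mul_eq_one_right h]
    exact Subgroup.inv_mem _ (Subgroup.mul_mem _ hx hy)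

/-- The images of the generators `x, y, z` in the model. -/
def modelGen : Fin 3 → Model :=
  ![⟨1, 1, 0, rfl⟩, ⟨0, 1, 1, rfl⟩, (⟨1, 1, 0, rfl⟩ * ⟨0, 1, 1, rfl⟩)⁻¹]

/-- The canonical map from the presentation to the model. -/
def toModel : HW →* Model :=
  PresentedGroup.toGroup (f := modelGen) (by
    rintro _ (rfl | rfl | rfl) <;> simp only [map_mul, map_inv, map_pow, FreeGroup.lift_apply_of]
    · rfl
    · rfl
    · exact mul_inv_cancel _)

lemma toModel_hwx : toModel hwx = ⟨1, 1, 0, rfl⟩ := PresentedGroup.toGroup.of _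

lemma toModel_hwy : toModel hwy = ⟨0, 1, 1, rfl⟩ := PresentedGroup.toGroup.of _

lemma toModel_word (i j k : ℤ) : toModel (word hwx hwy i j k) = Model.transl i j (-k) := by
  have ex : toModel (hwx * hwx) = Model.transl 1 0 0 := by rw [map_mul, toModel_hwx]; rfl
  have ey : toModel (hwy * hwy) = Model.transl 0 1 0 := by rw [map_mul, toModel_hwy]; rfl
  have ez : toModel (hwx * hwy * (hwx * hwy)) = Model.transl 0 0 (-1) := by
    simp only [map_mul, toModel_hwx, toModel_hwy]
    rfl
  rw [word, map_mul, map_mul, map_zpow, map_zpow, map_zpow, ex, ey, ez]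
  simp [Model.transl_zpow, Model.transl_mul]

lemma toModel_bijective : Function.Bijective toModel := by
  constructor
  · rw [injective_iff_map_eq_one]
    intro g hg
    obtain ⟨i, j, k, w, hw, rfl⟩ :=
      exists_eq_word hwx_semiconjBy hwy_semiconjBy closure_hwx_hwy g
    rw [map_mul, toModel_word] at hg
    have ha := congrArg Model.a hg
    have hb := congrArg Model.b hg
    have hc := congrArg Model.c hg
    rcases hw with rfl | rfl | rfl | rfl <;>
      simp [toModel_hwx, toModel_hwy, sgn_two_mul, sgn_neg] at ha hb hc
    · simp [ha, hb, hc, word]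
    all_goals omega
  · intro t
    obtain ⟨r, hr, u, v, w, rfl⟩ := Model.exists_mul_transl (h := toModel hwx) (k := toModel hwy)
      (by rw [toModel_hwx]; exact ⟨rfl, rfl⟩) (by rw [toModel_hwy]; exact ⟨rfl, rfl⟩) t
    have hw : toModel (word hwx hwy u v (-w)) = Model.transl u v w := by
      rw [toModel_word, neg_neg]
    obtain ⟨g, rfl⟩ : r ∈ toModel.range := by
      rcases hr with rfl | rfl | rfl | rfl
      · exact one_mem _
      · exact ⟨_, rfl⟩
      · exact ⟨_, rfl⟩
      · exact ⟨_, map_mul _ _ _⟩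
    exact ⟨g * word hwx hwy u v (-w), by rw [map_mul, hw]⟩

/-- The number of subgroups of given index isomorphic to the whole group is an isomorphism
invariant. -/
lemma card_subgroups_congr {G G' : Type*} [Group G] [Group G'] (e : G ≃* G') (n : ℕ) :
    Nat.card {H : Subgroup G // H.index = n ∧ Nonempty (H ≃* G)} =
      Nat.card {H : Subgroup G' // H.index = n ∧ Nonempty (H ≃* G')} := by
  refine Nat.card_congr (Equiv.subtypeEquiv e.mapSubgroup.toEquiv fun H => ?_)
  change _ ↔ (H.map e.toMonoidHom).index = n ∧ Nonempty (H.map e.toMonoidHom ≃* G')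
  have hi : (H.map e.toMonoidHom).index = H.index := H.index_map_equiv e
  rw [hi]
  refine and_congr_right fun _ => ⟨fun ⟨f⟩ => ?_, fun ⟨f⟩ => ?_⟩
  · exact ⟨((e.subgroupMap H).symm.trans f).trans e⟩
  · exact ⟨((e.subgroupMap H).trans f).trans e.symm⟩

theorem card_subgroups_HW {n : ℕ} (hn : 0 < n) :
    Nat.card {H : Subgroup HW // H.index = n ∧ Nonempty (H ≃* HW)} =
      n * (oddTriples n).card :=
  (card_subgroups_congr (MulEquiv.ofBijective toModel toModel_bijective) n).trans
    (Model.card_subgroups hn)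

end HantzscheWendt

theorem stmt12 (n : ℕ) (hn : 0 < n) :
    (Nat.card {H : Subgroup HW // H.index = n ∧ Nonempty (H ≃* HW)} : ℤ) =
        n * ((d3 n : ℤ) - 3 * d3If n 2 + 3 * d3If n 4 - d3If n 8) ∧
      Nat.card {H : Subgroup HW // H.index = n ∧ Nonempty (H ≃* HW)} =
        if Odd n then n * d3 n else 0 := by
  rw [HantzscheWendt.card_subgroups_HW hn]
  constructor
  · rw [Nat.cast_mul, HantzscheWendt.card_oddTriples_eq_alternating hn]
  · rw [HantzscheWendt.card_oddTriples hn, mul_ite, mul_zero]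
end
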